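/- Let λ ∈ (0, 2), let a, c, f ∈ C¹([−1,1]) with a(0) = 0 and (c − a'/2)(x) ≥ γ > 0 on [−1,1], and let 0 < ε ≤ 1. Let u ∈ C³([−1,1]) with u(−1) = u(1) = 0 solve −ε u'' + a u' + c u = f on (−1,1) and satisfy |u^{(i)}(x)| ≤ C_u (1 + (ε^{1/2} + |x|)^{λ−i}) for 0 ≤ i ≤ 3 and x ∈ [−1,1]. Let u_I be the continuous piecewise linear interpolant of u on the Liseikin mesh with parameter α satisfying 0 < α ≤ min{λ/2, 1/4}, and let u_N ∈ V^N be the piecewise linear Galerkin solution on this mesh. Then there is a constant C, independent of ε and N, with the supercloseness bound |||u_I − u_N|||_ε ≤ C N^{−2}. -/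

import Mathlib

/-- Liseikin's mesh generating function on `[-1,1]`. -/
noncomputable def liseikinPhi (α ε ξ : ℝ) : ℝ :=
  if 0 ≤ ξ then
    (ε ^ (α/2) + ξ * ((1 + ε ^ ((1:ℝ)/2)) ^ α - ε ^ (α/2))) ^ (1/α) - ε ^ ((1:ℝ)/2)
  else
    ε ^ ((1:ℝ)/2) - (ε ^ (α/2) + (-ξ) * ((1 + ε ^ ((1:ℝ)/2)) ^ α - ε ^ (α/2))) ^ (1/α)

/-- The Liseikin mesh points `x_i = φ(i/N, ε)`, `i = -N, …, N`. -/
noncomputable def liseikinX (α ε : ℝ) (N : ℕ) (i : ℤ) : ℝ :=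
  liseikinPhi α ε ((i : ℝ) / N)

/-- The bilinear form `B_ε(v,w) = ε∫ v'w' + ∫ a v' w + ∫ c v w` over `(-1,1)`,
with derivatives taken pointwise (piecewise for mesh functions; the finitely many
mesh points do not affect the integrals). -/
noncomputable def Beps (ε : ℝ) (a c : ℝ → ℝ) (v w : ℝ → ℝ) : ℝ :=
  ε * (∫ y in (-1:ℝ)..1, deriv v y * deriv w y)
    + (∫ y in (-1:ℝ)..1, a y * deriv v y * w y)
    + (∫ y in (-1:ℝ)..1, c y * v y * w y)

/-- The energy norm `|||v|||_ε = (ε∫ (v')² + ∫ v²)^{1/2}` over `(-1,1)`. -/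
noncomputable def energyNorm (ε : ℝ) (v : ℝ → ℝ) : ℝ :=
  Real.sqrt (ε * (∫ y in (-1:ℝ)..1, (deriv v y)^2) + ∫ y in (-1:ℝ)..1, (v y)^2)

/-- Membership in the piecewise linear space `V^N`: continuous on `[-1,1]`,
vanishing at `±1`, and affine on every mesh interval `[x_{i-1}, x_i]`. -/
def MemVN1 (x : ℤ → ℝ) (N : ℕ) (v : ℝ → ℝ) : Prop :=
  ContinuousOn v (Set.Icc (-1) 1) ∧ v (-1) = 0 ∧ v 1 = 0 ∧
  ∀ i : ℤ, -(N:ℤ) < i → i ≤ N → ∀ y ∈ Set.Icc (x (i-1)) (x i),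
    v y = v (x (i-1)) + (v (x i) - v (x (i-1))) / (x i - x (i-1)) * (y - x (i-1))

namespace Liseikin

open Set MeasureTheory

/-! ### Mean value estimates on an interval -/

theorem abs_sub_le_of_hasDerivAt {w w' : ℝ → ℝ} {p q D : ℝ}
    (hw : ContinuousOn w (Icc p q)) (hd : ∀ y ∈ Ioo p q, HasDerivAt w (w' y) y)
    (hD : ∀ y ∈ Ioo p q, |w' y| ≤ D) {y z : ℝ} (hy : y ∈ Icc p q) (hz : z ∈ Icc p q) :
    |w y - w z| ≤ D * |y - z| := by
  wlog hlt : z < y generalizing y z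
  · rcases (not_lt.1 hlt).eq_or_lt with rfl | h
    · simp
    · rw [abs_sub_comm, abs_sub_comm y]
      exact this hz hy h
  obtain ⟨x, hx, hxe⟩ := exists_hasDerivAt_eq_slope w w' hlt
    (hw.mono (Icc_subset_Icc hz.1 hy.2))
    (fun x hx => hd x ⟨hz.1.trans_lt hx.1, hx.2.trans_le hy.2⟩)
  have h0 : 0 < y - z := sub_pos.2 hlt
  have : w y - w z = w' x * (y - z) := by rw [hxe]; field_simp
  rw [this, abs_mul]
  exact mul_le_mul_of_nonneg_right
    (hD x ⟨hz.1.trans_lt hx.1, hx.2.trans_le hy.2⟩) (abs_nonneg _)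

theorem abs_le_of_zero_ends {w w1 w2 : ℝ → ℝ} {p q D : ℝ} (hpq : p < q)
    (hw : ContinuousOn w (Icc p q)) (hw1 : ContinuousOn w1 (Icc p q))
    (hd : ∀ y ∈ Ioo p q, HasDerivAt w (w1 y) y)
    (hd1 : ∀ y ∈ Ioo p q, HasDerivAt w1 (w2 y) y)
    (hD : ∀ y ∈ Ioo p q, |w2 y| ≤ D) (hp : w p = 0) (hq : w q = 0)
    {y : ℝ} (hy : y ∈ Icc p q) : |w y| ≤ D * (q - p) ^ 2 := by
  obtain ⟨z, hz, hze⟩ := exists_hasDerivAt_eq_slope w w1 hpq hw hd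
  have hz0 : w1 z = 0 := by simp [hze, hp, hq]
  have hD0 : 0 ≤ D := (abs_nonneg _).trans (hD z hz)
  have hb : ∀ x ∈ Ioo p q, |w1 x| ≤ D * (q - p) := by
    intro x hx
    have h := abs_sub_le_of_hasDerivAt hw1 hd1 hD (Ioo_subset_Icc_self hx)
      (Ioo_subset_Icc_self hz)
    rw [hz0, sub_zero] at h
    refine h.trans (mul_le_mul_of_nonneg_left ?_ hD0)
    rw [abs_le]; constructor <;> linarith [hx.1, hx.2, hz.1, hz.2]
  have h := abs_sub_le_of_hasDerivAt hw hd hb hy (left_mem_Icc.2 hpq.le)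
  rw [hp, sub_zero, abs_of_nonneg (sub_nonneg.2 hy.1)] at h
  refine h.trans ?_
  have : y - p ≤ q - p := by linarith [hy.2]
  calc D * (q - p) * (y - p) ≤ D * (q - p) * (q - p) :=
        mul_le_mul_of_nonneg_left this (mul_nonneg hD0 (by linarith))
    _ = D * (q - p) ^ 2 := by ring

/-- Inverse estimate for an affine function on an interval. -/
theorem abs_slope_mul_sq_le (v0 k : ℝ) {p q : ℝ} (hpq : p < q) :
    |k| * (q - p) ^ 2 ≤ 6 * ∫ y in p..q, |v0 + k * (y - p)| := by
  have hh : 0 < q - p := sub_pos.2 hpq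
  set m : ℝ := (p + q) / 2 with hm
  have h1 : ∫ y in p..q, (v0 + k * (y - p)) * (y - m) = k * (q - p) ^ 3 / 12 := by
    have := intervalIntegral.integral_eq_sub_of_hasDerivAt
      (f := fun y => v0 * (y - m) ^ 2 / 2 + k * ((y - p) ^ 3 / 3 - (m - p) * (y - p) ^ 2 / 2))
      (f' := fun y => (v0 + k * (y - p)) * (y - m)) (a := p) (b := q) ?_ ?_
    · rw [this, hm]; ring
    · intro y _
      have e1 : HasDerivAt (fun y : ℝ => y - m) 1 y := (hasDerivAt_id y).sub_const m
      have e2 : HasDerivAt (fun y : ℝ => y - p) 1 y := (hasDerivAt_id y).sub_const p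
      have := (((e1.pow 2).const_mul v0).div_const 2).add
        ((((e2.pow 3).div_const 3).sub (((e2.pow 2).const_mul (m - p)).div_const 2)).const_mul k)
      refine (this.congr_deriv ?_)
      simp only [Nat.cast_ofNat]
      ring
    · apply Continuous.intervalIntegrable; fun_prop
  have h2 : |∫ y in p..q, (v0 + k * (y - p)) * (y - m)|
      ≤ ∫ y in p..q, (q - p) / 2 * |v0 + k * (y - p)| := by
    refine (intervalIntegral.abs_integral_le_integral_abs hpq.le).trans ?_
    refine intervalIntegral.integral_mono_on hpq.le
      (by apply Continuous.intervalIntegrable; fun_prop)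
      (by apply Continuous.intervalIntegrable; fun_prop) ?_
    intro y hy
    rw [abs_mul, mul_comm]
    refine mul_le_mul_of_nonneg_right ?_ (abs_nonneg _)
    rw [abs_le]; constructor <;> linarith [hy.1, hy.2]
  rw [h1, intervalIntegral.integral_const_mul, abs_div, abs_mul, abs_of_pos (pow_pos hh 3),
    abs_of_pos (by norm_num : (0:ℝ) < 12)] at h2
  have h3 : (q - p) * (|k| * (q - p) ^ 2)
      ≤ (q - p) * (6 * ∫ y in p..q, |v0 + k * (y - p)|) := by linarith
  exact le_of_mul_le_mul_left h3 hh

/-! ### Functions that are continuous on every cell of a partition -/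

/-- `F` agrees on every open cell of the partition `t 0 < ⋯ < t n` with a function continuous on
the closed cell. -/
def PiecewiseCont (t : ℕ → ℝ) (n : ℕ) (F : ℝ → ℝ) : Prop :=
  ∀ j < n, ∃ g : ℝ → ℝ, ContinuousOn g (Icc (t j) (t (j + 1))) ∧ EqOn F g (Ioo (t j) (t (j + 1)))

section PiecewiseCont

variable {t : ℕ → ℝ} {n : ℕ} {F G : ℝ → ℝ}

theorem node_le_node (ht : ∀ j < n, t j < t (j + 1)) {i j : ℕ} (hij : i ≤ j) (hj : j ≤ n) :
    t i ≤ t j := by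
  induction j, hij using Nat.le_induction with
  | base => exact le_rfl
  | succ k _ ih => exact (ih (by omega)).trans (ht k (by omega)).le

theorem cell_subset (ht : ∀ j < n, t j < t (j + 1)) {j : ℕ} (hj : j < n) :
    Icc (t j) (t (j + 1)) ⊆ Icc (t 0) (t n) :=
  Icc_subset_Icc (node_le_node ht (Nat.zero_le j) hj.le) (node_le_node ht hj le_rfl)

theorem openCell_subset (ht : ∀ j < n, t j < t (j + 1)) {j : ℕ} (hj : j < n) :
    Ioo (t j) (t (j + 1)) ⊆ Ioo (t 0) (t n) :=
  Ioo_subset_Ioo (node_le_node ht (Nat.zero_le j) hj.le) (node_le_node ht hj le_rfl)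

theorem exists_cell (t : ℕ → ℝ) (n : ℕ) {y : ℝ} (hy : y ∈ Ico (t 0) (t n)) :
    ∃ j < n, y ∈ Ico (t j) (t (j + 1)) := by
  induction n with
  | zero => exact absurd (hy.1.trans_lt hy.2) (lt_irrefl _)
  | succ n ih =>
    rcases lt_or_ge y (t n) with h | h
    · obtain ⟨j, hj, hm⟩ := ih ⟨hy.1, h⟩
      exact ⟨j, by omega, hm⟩
    · exact ⟨n, by omega, h, hy.2⟩

theorem exists_openCell {y : ℝ} (hy : y ∈ Ioo (t 0) (t n) \ range t) :
    ∃ j < n, y ∈ Ioo (t j) (t (j + 1)) := by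
  obtain ⟨j, hj, hm⟩ := exists_cell t n (Ioo_subset_Ico_self hy.1)
  exact ⟨j, hj, lt_of_le_of_ne hm.1 (fun h => hy.2 ⟨j, h⟩), hm.2⟩

theorem PiecewiseCont.of_continuousOn (ht : ∀ j < n, t j < t (j + 1))
    (h : ContinuousOn F (Icc (t 0) (t n))) : PiecewiseCont t n F :=
  fun _ hj => ⟨F, h.mono (cell_subset ht hj), fun _ _ => rfl⟩

theorem PiecewiseCont.add (hF : PiecewiseCont t n F) (hG : PiecewiseCont t n G) :
    PiecewiseCont t n (fun y => F y + G y) := by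
  intro j hj
  obtain ⟨f, hf, hFf⟩ := hF j hj
  obtain ⟨g, hg, hGg⟩ := hG j hj
  exact ⟨fun y => f y + g y, hf.add hg, fun y hy => by simp only [hFf hy, hGg hy]⟩

theorem PiecewiseCont.mul (hF : PiecewiseCont t n F) (hG : PiecewiseCont t n G) :
    PiecewiseCont t n (fun y => F y * G y) := by
  intro j hj
  obtain ⟨f, hf, hFf⟩ := hF j hj
  obtain ⟨g, hg, hGg⟩ := hG j hj
  exact ⟨fun y => f y * g y, hf.mul hg, fun y hy => by simp only [hFf hy, hGg hy]⟩

theorem PiecewiseCont.sub (hF : PiecewiseCont t n F) (hG : PiecewiseCont t n G) :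
    PiecewiseCont t n (fun y => F y - G y) := by
  intro j hj
  obtain ⟨f, hf, hFf⟩ := hF j hj
  obtain ⟨g, hg, hGg⟩ := hG j hj
  exact ⟨fun y => f y - g y, hf.sub hg, fun y hy => by simp only [hFf hy, hGg hy]⟩

theorem PiecewiseCont.const (c : ℝ) : PiecewiseCont t n (fun _ => c) :=
  fun _ _ => ⟨fun _ => c, continuousOn_const, fun _ _ => rfl⟩

theorem PiecewiseCont.abs (hF : PiecewiseCont t n F) : PiecewiseCont t n (fun y => |F y|) := by
  intro j hj
  obtain ⟨f, hf, hFf⟩ := hF j hj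
  exact ⟨fun y => |f y|, hf.abs, fun y hy => by simp only [hFf hy]⟩

theorem PiecewiseCont.pow (hF : PiecewiseCont t n F) (m : ℕ) :
    PiecewiseCont t n (fun y => F y ^ m) := by
  intro j hj
  obtain ⟨f, hf, hFf⟩ := hF j hj
  exact ⟨fun y => f y ^ m, hf.pow m, fun y hy => by simp only [hFf hy]⟩

theorem PiecewiseCont.intervalIntegrable_cell (ht : ∀ j < n, t j < t (j + 1))
    (hF : PiecewiseCont t n F) {j : ℕ} (hj : j < n) :
    IntervalIntegrable F volume (t j) (t (j + 1)) := by
  obtain ⟨f, hf, hFf⟩ := hF j hj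
  have h : IntervalIntegrable f volume (t j) (t (j + 1)) :=
    (hf.mono (by rw [uIcc_of_le (ht j hj).le])).intervalIntegrable
  refine h.congr_uIoo ?_
  rw [uIoo_of_le (ht j hj).le]
  exact hFf.symm

theorem PiecewiseCont.intervalIntegrable (ht : ∀ j < n, t j < t (j + 1))
    (hF : PiecewiseCont t n F) : IntervalIntegrable F volume (t 0) (t n) :=
  IntervalIntegrable.trans_iterate fun _ hj => hF.intervalIntegrable_cell ht hj

theorem PiecewiseCont.integral_eq_sum (ht : ∀ j < n, t j < t (j + 1))
    (hF : PiecewiseCont t n F) :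
    ∫ y in (t 0)..(t n), F y = ∑ j ∈ Finset.range n, ∫ y in (t j)..(t (j + 1)), F y :=
  (intervalIntegral.sum_integral_adjacent_intervals (a := t)
    fun _ hj => hF.intervalIntegrable_cell ht hj).symm

theorem PiecewiseCont.integral_hasDerivAt (ht : ∀ j < n, t j < t (j + 1))
    (hF : ContinuousOn F (Icc (t 0) (t n))) (hG : PiecewiseCont t n G)
    (hd : ∀ y ∈ Ioo (t 0) (t n) \ range t, HasDerivAt F (G y) y) :
    ∫ y in (t 0)..(t n), G y = F (t n) - F (t 0) :=
  integral_eq_of_hasDerivAt_off_countable_of_le F G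
    (node_le_node ht (Nat.zero_le n) le_rfl) (countable_range t) hF hd (hG.intervalIntegrable ht)

end PiecewiseCont

/-! ### Continuous piecewise affine functions -/

/-- `v` is continuous, vanishes at both ends, and is affine on each cell. -/
structure PiecewiseAffine (t : ℕ → ℝ) (n : ℕ) (v : ℝ → ℝ) : Prop where
  cont : ContinuousOn v (Icc (t 0) (t n))
  left : v (t 0) = 0
  right : v (t n) = 0
  affine : ∀ j < n, ∃ k : ℝ, ∀ y ∈ Icc (t j) (t (j + 1)), v y = v (t j) + k * (y - t j)

section PiecewiseAffine

variable {t : ℕ → ℝ} {n : ℕ} {v : ℝ → ℝ}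

theorem hasDerivAt_of_affine {p q v0 k : ℝ}
    (h : ∀ y ∈ Icc p q, v y = v0 + k * (y - p)) {y : ℝ} (hy : y ∈ Ioo p q) :
    HasDerivAt v k y := by
  have h1 : HasDerivAt (fun y : ℝ => v0 + k * (y - p)) k y := by
    simpa using (((hasDerivAt_id y).sub_const p).const_mul k).const_add v0
  refine h1.congr_of_eventuallyEq ?_
  filter_upwards [Icc_mem_nhds hy.1 hy.2] with z hz using h z hz

theorem PiecewiseAffine.piecewiseCont_deriv (hv : PiecewiseAffine t n v) :
    PiecewiseCont t n (deriv v) := by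
  intro j hj
  obtain ⟨k, hk⟩ := hv.affine j hj
  exact ⟨fun _ => k, continuousOn_const, fun y hy => (hasDerivAt_of_affine hk hy).deriv⟩

theorem PiecewiseAffine.hasDerivAt (hv : PiecewiseAffine t n v) {y : ℝ}
    (hy : y ∈ Ioo (t 0) (t n) \ range t) : HasDerivAt v (deriv v y) y := by
  obtain ⟨j, hj, hm⟩ := exists_openCell hy
  obtain ⟨k, hk⟩ := hv.affine j hj
  exact (hasDerivAt_of_affine hk hm).differentiableAt.hasDerivAt

theorem PiecewiseAffine.sub {w : ℝ → ℝ} (hv : PiecewiseAffine t n v)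
    (hw : PiecewiseAffine t n w) : PiecewiseAffine t n (fun y => v y - w y) where
  cont := hv.cont.sub hw.cont
  left := by simp [hv.left, hw.left]
  right := by simp [hv.right, hw.right]
  affine j hj := by
    obtain ⟨k, hk⟩ := hv.affine j hj
    obtain ⟨l, hl⟩ := hw.affine j hj
    exact ⟨k - l, fun y hy => by rw [hk y hy, hl y hy]; ring⟩

/-- Integrating `φ χ'` for a piecewise affine `χ`, when `φ` has small mean on each cell. -/
theorem PiecewiseAffine.abs_integral_mul_deriv_le (ht : ∀ j < n, t j < t (j + 1))
    (hv : PiecewiseAffine t n v) {φ : ℝ → ℝ} (hφ : ContinuousOn φ (Icc (t 0) (t n))) {M : ℝ}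
    (hM : ∀ j < n, |∫ y in (t j)..(t (j + 1)), φ y| ≤ M * (t (j + 1) - t j) ^ 2) (hM0 : 0 ≤ M) :
    |∫ y in (t 0)..(t n), φ y * deriv v y| ≤ 6 * M * ∫ y in (t 0)..(t n), |v y| := by
  have hφ' := PiecewiseCont.of_continuousOn ht hφ
  have hv' := (PiecewiseCont.of_continuousOn ht hv.cont).abs
  rw [(hφ'.mul hv.piecewiseCont_deriv).integral_eq_sum ht, hv'.integral_eq_sum ht,
    Finset.mul_sum]
  refine (Finset.abs_sum_le_sum_abs _ _).trans (Finset.sum_le_sum fun j hj => ?_)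
  rw [Finset.mem_range] at hj
  obtain ⟨k, hk⟩ := hv.affine j hj
  have e1 : ∫ y in (t j)..(t (j + 1)), φ y * deriv v y
      = (∫ y in (t j)..(t (j + 1)), φ y) * k := by
    rw [← intervalIntegral.integral_mul_const]
    refine intervalIntegral.integral_congr_Ioo_of_le (ht j hj).le fun y hy => ?_
    simp only [(hasDerivAt_of_affine hk hy).deriv]
  have e2 : ∫ y in (t j)..(t (j + 1)), |v y|
      = ∫ y in (t j)..(t (j + 1)), |v (t j) + k * (y - t j)| := by
    refine intervalIntegral.integral_congr_Ioo_of_le (ht j hj).le fun y hy => ?_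
    simp only [hk y (Ioo_subset_Icc_self hy)]
  rw [e1, e2, abs_mul]
  have h3 := abs_slope_mul_sq_le (v (t j)) k (ht j hj)
  calc _ ≤ M * (t (j + 1) - t j) ^ 2 * |k| :=
        mul_le_mul_of_nonneg_right (hM j hj) (abs_nonneg _)
    _ = M * (|k| * (t (j + 1) - t j) ^ 2) := by ring
    _ ≤ M * (6 * ∫ y in (t j)..(t (j + 1)), |v (t j) + k * (y - t j)|) :=
        mul_le_mul_of_nonneg_left h3 hM0
    _ = _ := by ring

end PiecewiseAffine

/-! ### The abstract energy estimate -/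

section Energy

variable {t : ℕ → ℝ} {n : ℕ} {F G : ℝ → ℝ}

theorem ae_openCell (t : ℕ → ℝ) (n : ℕ) :
    ∀ᵐ y ∂volume.restrict (Icc (t 0) (t n)), y ∈ Ioo (t 0) (t n) \ range t := by
  have h1 : ∀ᵐ y ∂volume.restrict (Icc (t 0) (t n)), y ∉ range t :=
    (countable_range t).ae_notMem _
  filter_upwards [ae_restrict_mem measurableSet_Icc, h1] with y hy hyt
  exact ⟨⟨lt_of_le_of_ne hy.1 fun e => hyt ⟨0, e⟩,
    lt_of_le_of_ne hy.2 fun e => hyt ⟨n, e.symm⟩⟩, hyt⟩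

theorem integral_congr_off_nodes (h : t 0 ≤ t n)
    (hFG : ∀ y ∈ Ioo (t 0) (t n) \ range t, F y = G y) :
    ∫ y in (t 0)..(t n), F y = ∫ y in (t 0)..(t n), G y := by
  refine intervalIntegral.integral_congr_ae_restrict ?_
  rw [uIoc_of_le h]
  refine Filter.Eventually.filter_mono (ae_mono (Measure.restrict_mono Ioc_subset_Icc_self le_rfl)) ?_
  filter_upwards [ae_openCell t n] with y hy using hFG y hy

theorem PiecewiseCont.integral_mono (ht : ∀ j < n, t j < t (j + 1)) (hF : PiecewiseCont t n F)
    (hG : PiecewiseCont t n G) (hFG : ∀ y ∈ Ioo (t 0) (t n) \ range t, F y ≤ G y) :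
    ∫ y in (t 0)..(t n), F y ≤ ∫ y in (t 0)..(t n), G y := by
  have h := node_le_node ht (Nat.zero_le n) le_rfl
  refine intervalIntegral.integral_mono_ae_restrict h (hF.intervalIntegrable ht)
    (hG.intervalIntegrable ht) ?_
  filter_upwards [ae_openCell t n] with y hy using hFG y hy

/-- Error equation and coercivity, for an interpolation error `uI - u` that vanishes at the
nodes; `G` is a smooth approximation of the cell means of `a (uI - u)`. -/
theorem energy_bound (ht : ∀ j < n, t j < t (j + 1))
    {ε γ M : ℝ} {a a1 c f u u1 u2 uI uN G1 : ℝ → ℝ} (hM : 0 ≤ M)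
    (ha : ContinuousOn a (Icc (t 0) (t n))) (ha1 : ContinuousOn a1 (Icc (t 0) (t n)))
    (hc : ContinuousOn c (Icc (t 0) (t n))) (hf : ContinuousOn f (Icc (t 0) (t n)))
    (hda : ∀ y ∈ Ioo (t 0) (t n), HasDerivAt a (a1 y) y)
    (hcoer : ∀ y ∈ Ioo (t 0) (t n), γ ≤ c y - a1 y / 2)
    (hu : ContinuousOn u (Icc (t 0) (t n))) (hu1 : ContinuousOn u1 (Icc (t 0) (t n)))
    (hu2 : ContinuousOn u2 (Icc (t 0) (t n)))
    (hdu : ∀ y ∈ Ioo (t 0) (t n), HasDerivAt u (u1 y) y)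
    (hdu1 : ∀ y ∈ Ioo (t 0) (t n), HasDerivAt u1 (u2 y) y)
    (hode : ∀ y ∈ Ioo (t 0) (t n), -ε * u2 y + a y * u1 y + c y * u y = f y)
    (hI : PiecewiseAffine t n uI) (hN : PiecewiseAffine t n uN)
    (hnode : ∀ j ≤ n, uI (t j) = u (t j))
    (hgal : ε * (∫ y in (t 0)..(t n), deriv uN y * deriv (fun y => uI y - uN y) y)
      + (∫ y in (t 0)..(t n), a y * deriv uN y * (uI y - uN y))
      + (∫ y in (t 0)..(t n), c y * uN y * (uI y - uN y))
      = ∫ y in (t 0)..(t n), f y * (uI y - uN y))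
    (hG : ContinuousOn G (Icc (t 0) (t n))) (hG1 : PiecewiseCont t n G1)
    (hdG : ∀ y ∈ Ioo (t 0) (t n) \ range t, HasDerivAt G (G1 y) y)
    (hcell : ∀ j < n, |∫ y in (t j)..(t (j + 1)), (a y * (uI y - u y) - G y)|
      ≤ M * (t (j + 1) - t j) ^ 2)
    (hG1M : ∀ y ∈ Ioo (t 0) (t n) \ range t, |G1 y| ≤ M)
    (heM : ∀ y ∈ Ioo (t 0) (t n), |(c y - a1 y) * (uI y - u y)| ≤ M) :
    ε * (∫ y in (t 0)..(t n), deriv (fun y => uI y - uN y) y ^ 2)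
      + γ * (∫ y in (t 0)..(t n), (uI y - uN y) ^ 2)
      ≤ 8 * M * ∫ y in (t 0)..(t n), |uI y - uN y| := by
  have hX := hI.sub hN
  set χ : ℝ → ℝ := fun y => uI y - uN y with hχ
  change ε * (∫ y in (t 0)..(t n), deriv χ y ^ 2) + γ * (∫ y in (t 0)..(t n), χ y ^ 2)
    ≤ 8 * M * ∫ y in (t 0)..(t n), |χ y|
  change ε * (∫ y in (t 0)..(t n), deriv uN y * deriv χ y)
      + (∫ y in (t 0)..(t n), a y * deriv uN y * χ y)
      + (∫ y in (t 0)..(t n), c y * uN y * χ y)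
      = ∫ y in (t 0)..(t n), f y * χ y at hgal
  have hle := node_le_node ht (Nat.zero_le n) le_rfl
  have pc {H : ℝ → ℝ} (h : ContinuousOn H (Icc (t 0) (t n))) : PiecewiseCont t n H :=
    .of_continuousOn ht h
  have pd := hX.piecewiseCont_deriv
  have pdI := hI.piecewiseCont_deriv
  have pdN := hN.piecewiseCont_deriv
  have pχ := pc hX.cont
  have hdd : ∀ y ∈ Ioo (t 0) (t n) \ range t, deriv χ y = deriv uI y - deriv uN y :=
    fun y hy => ((hI.hasDerivAt hy).sub (hN.hasDerivAt hy)).deriv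
  have he : ContinuousOn (fun y => uI y - u y) (Icc (t 0) (t n)) := hI.cont.sub hu
  have hde : ∀ y ∈ Ioo (t 0) (t n) \ range t,
      HasDerivAt (fun y => uI y - u y) (deriv uI y - u1 y) y :=
    fun y hy => (hI.hasDerivAt hy).sub (hdu y hy.1)
  have pe := pc he
  -- the weak form of the differential equation
  have pF1 : PiecewiseCont t n
      (fun y => ε * (deriv uN y * deriv χ y) + a y * deriv uN y * χ y + c y * uN y * χ y
        - f y * χ y) :=
    (((((PiecewiseCont.const ε).mul (pdN.mul pd))).add (((pc ha).mul pdN).mul pχ)).add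
      (((pc hc).mul (pc hN.cont)).mul pχ)).sub ((pc hf).mul pχ)
  have i1 : ∫ y in (t 0)..(t n), (ε * (deriv uN y * deriv χ y) + a y * deriv uN y * χ y
      + c y * uN y * χ y - f y * χ y) = 0 := by
    have q1 := ((PiecewiseCont.const ε).mul (pdN.mul pd)).intervalIntegrable ht
    have q2 := (((pc ha).mul pdN).mul pχ).intervalIntegrable ht
    have q3 := (((pc hc).mul (pc hN.cont)).mul pχ).intervalIntegrable ht
    have q4 := ((pc hf).mul pχ).intervalIntegrable ht
    rw [intervalIntegral.integral_sub ((q1.add q2).add q3) q4,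
      intervalIntegral.integral_add (q1.add q2) q3, intervalIntegral.integral_add q1 q2,
      intervalIntegral.integral_const_mul, hgal, sub_self]
  have pF2 : PiecewiseCont t n (fun y => u2 y * χ y + u1 y * deriv χ y) :=
    ((pc hu2).mul pχ).add ((pc hu1).mul pd)
  have i2 : ∫ y in (t 0)..(t n), (u2 y * χ y + u1 y * deriv χ y) = 0 := by
    rw [PiecewiseCont.integral_hasDerivAt ht (hu1.mul hX.cont) pF2
      fun y hy => (hdu1 y hy.1).mul (hX.hasDerivAt hy)]
    simp [hX.left, hX.right]
  have pF3 : PiecewiseCont t n (fun y => (a1 y * χ y + a y * deriv χ y) * χ y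
      + a y * χ y * deriv χ y) :=
    ((((pc ha1).mul pχ).add ((pc ha).mul pd)).mul pχ).add (((pc ha).mul pχ).mul pd)
  have i3 : ∫ y in (t 0)..(t n), ((a1 y * χ y + a y * deriv χ y) * χ y
      + a y * χ y * deriv χ y) = 0 := by
    rw [PiecewiseCont.integral_hasDerivAt ht ((ha.mul hX.cont).mul hX.cont) pF3
      fun y hy => ((hda y hy.1).mul (hX.hasDerivAt hy)).mul (hX.hasDerivAt hy)]
    simp [hX.left, hX.right]
  have pF4 : PiecewiseCont t n (fun y => (a1 y * (uI y - u y) + a y * (deriv uI y - u1 y)) * χ y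
      + a y * (uI y - u y) * deriv χ y) :=
    ((((pc ha1).mul pe).add ((pc ha).mul (pdI.sub (pc hu1)))).mul pχ).add
      (((pc ha).mul pe).mul pd)
  have i4 : ∫ y in (t 0)..(t n), ((a1 y * (uI y - u y) + a y * (deriv uI y - u1 y)) * χ y
      + a y * (uI y - u y) * deriv χ y) = 0 := by
    rw [PiecewiseCont.integral_hasDerivAt ht ((ha.mul he).mul hX.cont) pF4
      fun y hy => ((hda y hy.1).mul (hde y hy)).mul (hX.hasDerivAt hy)]
    simp [hX.left, hX.right]
  have pF5 : PiecewiseCont t n (fun y => G1 y * χ y + G y * deriv χ y) :=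
    (hG1.mul pχ).add ((pc hG).mul pd)
  have i5 : ∫ y in (t 0)..(t n), (G1 y * χ y + G y * deriv χ y) = 0 := by
    rw [PiecewiseCont.integral_hasDerivAt ht (hG.mul hX.cont) pF5
      fun y hy => (hdG y hy).mul (hX.hasDerivAt hy)]
    simp [hX.left, hX.right]
  have pF6 : PiecewiseCont t n (fun y => (deriv uI y - u1 y) * deriv χ y) :=
    (pdI.sub (pc hu1)).mul pd
  have i6 : ∫ y in (t 0)..(t n), (deriv uI y - u1 y) * deriv χ y = 0 := by
    rw [pF6.integral_eq_sum ht]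
    refine Finset.sum_eq_zero fun j hj => ?_
    rw [Finset.mem_range] at hj
    obtain ⟨k, hk⟩ := hX.affine j hj
    obtain ⟨l, hl⟩ := hI.affine j hj
    have h1 : ∫ y in (t j)..(t (j + 1)), (deriv uI y - u1 y) * deriv χ y
        = ∫ y in (t j)..(t (j + 1)), (l - u1 y) * k := by
      refine intervalIntegral.integral_congr_Ioo_of_le (ht j hj).le fun y hy => ?_
      simp only [(hasDerivAt_of_affine hk hy).deriv, (hasDerivAt_of_affine hl hy).deriv]
    have h2 : ∫ y in (t j)..(t (j + 1)), (l - u1 y)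
        = (uI (t (j + 1)) - u (t (j + 1))) - (uI (t j) - u (t j)) := by
      refine intervalIntegral.integral_eq_sub_of_hasDerivAt_of_le (ht j hj).le
        (he.mono (cell_subset ht hj))
        (fun y hy => (hasDerivAt_of_affine hl hy).sub (hdu y (openCell_subset ht hj hy))) ?_
      exact ((continuousOn_const.sub (hu1.mono (cell_subset ht hj))).mono
        (by rw [uIcc_of_le (ht j hj).le])).intervalIntegrable
    rw [h1, intervalIntegral.integral_mul_const, h2, hnode _ hj, hnode _ hj.le]
    ring
  have pR : PiecewiseCont t n (fun y => (a y * (uI y - u y) - G y) * deriv χ y) :=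
    (((pc ha).mul pe).sub (pc hG)).mul pd
  have hR := hX.abs_integral_mul_deriv_le ht (φ := fun y => a y * (uI y - u y) - G y)
    ((ha.mul he).sub hG) hcell hM
  have pP : PiecewiseCont t n (fun y => ε * deriv χ y ^ 2 + (c y - a1 y / 2) * χ y ^ 2) :=
    ((PiecewiseCont.const ε).mul (pd.pow 2)).add
      ((pc (hc.sub (ha1.div_const 2))).mul (pχ.pow 2))
  have pQ : PiecewiseCont t n (fun y => (c y - a1 y) * (uI y - u y) * χ y + G1 y * χ y) :=
    (((pc (hc.sub ha1)).mul pe).mul pχ).add (hG1.mul pχ)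
  have key : ∫ y in (t 0)..(t n), (ε * deriv χ y ^ 2 + (c y - a1 y / 2) * χ y ^ 2)
      = (∫ y in (t 0)..(t n), ((c y - a1 y) * (uI y - u y) * χ y + G1 y * χ y))
        - ∫ y in (t 0)..(t n), (a y * (uI y - u y) - G y) * deriv χ y := by
    have q1 := pF1.intervalIntegrable ht
    have q2 := (pF2.intervalIntegrable ht).const_mul ε
    have q3 := (pF3.intervalIntegrable ht).const_mul (1 / 2)
    have q4 := pF4.intervalIntegrable ht
    have q5 := pF5.intervalIntegrable ht
    have q6 := (pF6.intervalIntegrable ht).const_mul ε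
    have qQ := pQ.intervalIntegrable ht
    have qR := pR.intervalIntegrable ht
    have hpt := integral_congr_off_nodes (t := t) (n := n)
      (F := fun y => ε * deriv χ y ^ 2 + (c y - a1 y / 2) * χ y ^ 2)
      (G := fun y => ((c y - a1 y) * (uI y - u y) * χ y + G1 y * χ y)
        - (a y * (uI y - u y) - G y) * deriv χ y
        - (ε * (deriv uN y * deriv χ y) + a y * deriv uN y * χ y + c y * uN y * χ y - f y * χ y)
        + ε * (u2 y * χ y + u1 y * deriv χ y)
        - 1 / 2 * ((a1 y * χ y + a y * deriv χ y) * χ y + a y * χ y * deriv χ y)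
        + ((a1 y * (uI y - u y) + a y * (deriv uI y - u1 y)) * χ y
          + a y * (uI y - u y) * deriv χ y)
        - (G1 y * χ y + G y * deriv χ y)
        + ε * ((deriv uI y - u1 y) * deriv χ y)) hle ?_
    · rw [hpt, intervalIntegral.integral_add
          ((((((qQ.sub qR).sub q1).add q2).sub q3).add q4).sub q5) q6,
        intervalIntegral.integral_sub ((((((qQ.sub qR).sub q1).add q2).sub q3).add q4)) q5,
        intervalIntegral.integral_add (((((qQ.sub qR).sub q1).add q2).sub q3)) q4,
        intervalIntegral.integral_sub ((((qQ.sub qR).sub q1).add q2)) q3,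
        intervalIntegral.integral_add (((qQ.sub qR).sub q1)) q2,
        intervalIntegral.integral_sub ((qQ.sub qR)) q1,
        intervalIntegral.integral_sub qQ qR,
        intervalIntegral.integral_const_mul, intervalIntegral.integral_const_mul,
        intervalIntegral.integral_const_mul, i1, i2, i3, i4, i5, i6]
      ring
    · intro y hy
      have h1 := hdd y hy
      have h2 := hode y hy.1
      have h3 : χ y = uI y - uN y := rfl
      have h4 : deriv uI y = deriv χ y + deriv uN y := by linarith
      have h5 : uI y = χ y + uN y := by linarith
      rw [← h2, h4, h5]
      ring
  have pA := pχ.abs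
  have lower : ε * (∫ y in (t 0)..(t n), deriv χ y ^ 2) + γ * (∫ y in (t 0)..(t n), χ y ^ 2)
      ≤ ∫ y in (t 0)..(t n), (ε * deriv χ y ^ 2 + (c y - a1 y / 2) * χ y ^ 2) := by
    have p1 := (PiecewiseCont.const ε).mul (pd.pow 2)
    have p2 := (PiecewiseCont.const γ).mul (pχ.pow 2)
    rw [← intervalIntegral.integral_const_mul, ← intervalIntegral.integral_const_mul,
      ← intervalIntegral.integral_add (p1.intervalIntegrable ht) (p2.intervalIntegrable ht)]
    refine PiecewiseCont.integral_mono ht (p1.add p2) pP fun y hy => ?_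
    have := mul_le_mul_of_nonneg_right (hcoer y hy.1) (sq_nonneg (χ y))
    linarith
  have upper : ∫ y in (t 0)..(t n), ((c y - a1 y) * (uI y - u y) * χ y + G1 y * χ y)
      ≤ 2 * M * ∫ y in (t 0)..(t n), |χ y| := by
    rw [← intervalIntegral.integral_const_mul]
    refine PiecewiseCont.integral_mono ht pQ ((PiecewiseCont.const (2 * M)).mul pA)
      fun y hy => ?_
    have h1 : (c y - a1 y) * (uI y - u y) * χ y ≤ M * |χ y| :=
      (le_abs_self _).trans (by
        rw [abs_mul]; exact mul_le_mul_of_nonneg_right (heM y hy.1) (abs_nonneg _))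
    have h2 : G1 y * χ y ≤ M * |χ y| :=
      (le_abs_self _).trans (by
        rw [abs_mul]; exact mul_le_mul_of_nonneg_right (hG1M y hy) (abs_nonneg _))
    linarith
  have := (abs_le.1 hR).1
  linarith

/-- Absorbing the `L¹` term of `energy_bound` by Young's inequality. -/
theorem sqrt_energy_le (hle : t 0 ≤ t n) {γ M A : ℝ} {v : ℝ → ℝ} (hγ : 0 < γ) (hM : 0 ≤ M)
    (hv : ContinuousOn v (Icc (t 0) (t n))) (hlen : t n - t 0 = 2) (hA : 0 ≤ A)
    (h : A + γ * (∫ y in (t 0)..(t n), v y ^ 2) ≤ M * ∫ y in (t 0)..(t n), |v y|) :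
    √(A + ∫ y in (t 0)..(t n), v y ^ 2) ≤ M * √((1 + 2 / γ) / γ) := by
  have hv' : ContinuousOn v (uIcc (t 0) (t n)) := by rwa [uIcc_of_le hle]
  have hv2 : IntervalIntegrable (fun y => v y ^ 2) volume (t 0) (t n) :=
    (hv'.pow 2).intervalIntegrable
  have h1 : M * ∫ y in (t 0)..(t n), |v y| ≤
      M ^ 2 / γ + γ / 2 * ∫ y in (t 0)..(t n), v y ^ 2 := by
    have e : M ^ 2 / γ + γ / 2 * ∫ y in (t 0)..(t n), v y ^ 2
        = ∫ y in (t 0)..(t n), (M ^ 2 / (2 * γ) + γ / 2 * v y ^ 2) := by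
      rw [intervalIntegral.integral_add intervalIntegrable_const
        (hv2.const_mul _), intervalIntegral.integral_const_mul,
        intervalIntegral.integral_const, hlen, smul_eq_mul]
      field_simp
    rw [e, ← intervalIntegral.integral_const_mul]
    refine intervalIntegral.integral_mono_on hle (hv'.abs.intervalIntegrable.const_mul _)
      (intervalIntegrable_const.add (hv2.const_mul _)) fun y _ => ?_
    have e2 : M ^ 2 / (2 * γ) + γ / 2 * v y ^ 2 - M * |v y| = (M - γ * |v y|) ^ 2 / (2 * γ) := by
      rw [← sq_abs (v y)]; field_simp; ring
    have : 0 ≤ (M - γ * |v y|) ^ 2 / (2 * γ) := by positivity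
    linarith
  set V := ∫ y in (t 0)..(t n), v y ^ 2 with hV
  have hV0 : 0 ≤ V := intervalIntegral.integral_nonneg hle fun y _ => sq_nonneg _
  have h2 : A + γ / 2 * V ≤ M ^ 2 / γ := by linarith
  have h3 : A + V ≤ (1 + 2 / γ) * (A + γ / 2 * V) := by
    have : (1 + 2 / γ) * (A + γ / 2 * V) = A + V + γ / 2 * V + 2 / γ * A := by
      field_simp; ring
    rw [this]
    have : 0 ≤ γ / 2 * V + 2 / γ * A := by positivity
    linarith
  refine Real.sqrt_le_iff.2 ⟨by positivity, ?_⟩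
  rw [mul_pow, Real.sq_sqrt (by positivity)]
  calc A + V ≤ (1 + 2 / γ) * (M ^ 2 / γ) := h3.trans (by gcongr)
    _ = _ := by ring

end Energy

/-! ### Powers of the layer variable `s = √ε + |y|` -/

theorem rpow_le_four {s b : ℝ} (hs : 0 < s) (hs2 : s ≤ 2) (hb : 0 ≤ b) (hb2 : b ≤ 2) :
    s ^ b ≤ 4 := by
  calc s ^ b ≤ 2 ^ b := Real.rpow_le_rpow hs.le hs2 hb
    _ ≤ 2 ^ (2 : ℝ) := Real.rpow_le_rpow_of_exponent_le (by norm_num) hb2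
    _ = 4 := by norm_num

theorem weight_le {s α lam : ℝ} (hs : 0 < s) (hs2 : s ≤ 2) (hα0 : 0 < α) (hα : α ≤ 1 / 4)
    (hαl : α ≤ lam / 2) (hlam : lam < 2) : s ^ (2 - 2 * α) * (1 + s ^ (lam - 2)) ≤ 8 := by
  have h1 : s ^ (2 - 2 * α) * s ^ (lam - 2) = s ^ (lam - 2 * α) := by
    rw [← Real.rpow_add hs]; ring_nf
  rw [mul_add, mul_one, h1]
  have := rpow_le_four hs hs2 (b := 2 - 2 * α) (by linarith) (by linarith)
  have := rpow_le_four hs hs2 (b := lam - 2 * α) (by linarith) (by linarith)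
  linarith

theorem mul_third_le {s lam : ℝ} (hs : 0 < s) (hs2 : s ≤ 2) :
    s * (1 + s ^ (lam - 3)) ≤ 2 * (1 + s ^ (lam - 2)) := by
  have h1 : s * s ^ (lam - 3) = s ^ (lam - 2) := by
    rw [show lam - 2 = 1 + (lam - 3) by ring, Real.rpow_add hs, Real.rpow_one]
  have := Real.rpow_nonneg hs.le (lam - 2)
  rw [mul_add, h1]; linarith

/-! ### Data of the problem -/

/-- A convection coefficient with a zero at the origin, together with its derivative. -/
structure Convection (L : ℝ) (a a1 : ℝ → ℝ) : Prop where
  cont : ContinuousOn a (Icc (-1) 1)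
  cont1 : ContinuousOn a1 (Icc (-1) 1)
  deriv : ∀ y ∈ Ioo (-1 : ℝ) 1, HasDerivAt a (a1 y) y
  bound1 : ∀ y ∈ Icc (-1 : ℝ) 1, |a1 y| ≤ L
  zero : a 0 = 0

/-- A `C³` function with its first three derivatives, obeying layer bounds with `η = √ε`. -/
structure LayerFunction (lam Cu η : ℝ) (u u1 u2 u3 : ℝ → ℝ) : Prop where
  cont : ContinuousOn u (Icc (-1) 1)
  cont1 : ContinuousOn u1 (Icc (-1) 1)
  cont2 : ContinuousOn u2 (Icc (-1) 1)
  cont3 : ContinuousOn u3 (Icc (-1) 1)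
  deriv : ∀ y ∈ Ioo (-1 : ℝ) 1, HasDerivAt u (u1 y) y
  deriv1 : ∀ y ∈ Ioo (-1 : ℝ) 1, HasDerivAt u1 (u2 y) y
  deriv2 : ∀ y ∈ Ioo (-1 : ℝ) 1, HasDerivAt u2 (u3 y) y
  bound1 : ∀ y ∈ Icc (-1 : ℝ) 1, |u1 y| ≤ Cu * (1 + (η + |y|) ^ (lam - 1))
  bound2 : ∀ y ∈ Icc (-1 : ℝ) 1, |u2 y| ≤ Cu * (1 + (η + |y|) ^ (lam - 2))
  bound3 : ∀ y ∈ Icc (-1 : ℝ) 1, |u3 y| ≤ Cu * (1 + (η + |y|) ^ (lam - 3))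

/-- A cell `[p, q]` of Liseikin's mesh, on which `η + |y|` ranges between `s0` and `s1`. -/
structure MeshCell (α η κ p q s0 s1 : ℝ) : Prop where
  lt : p < q
  left : -1 ≤ p
  right : q ≤ 1
  pos : 0 < s0
  le_two : s1 ≤ 2
  sub : s1 - s0 = q - p
  rpow_sub : s1 ^ α - s0 ^ α = κ
  lower : ∀ y ∈ Icc p q, s0 ≤ η + |y|
  upper : ∀ y ∈ Icc p q, η + |y| ≤ s1
  side : 0 ≤ p ∨ q ≤ 0
  first : κ ≤ s0 ^ α ∨ ∀ y ∈ Icc p q, |y| ≤ q - p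

theorem Convection.lip {L : ℝ} {a a1 : ℝ → ℝ} (h : Convection L a a1) {y z : ℝ}
    (hy : y ∈ Icc (-1 : ℝ) 1) (hz : z ∈ Icc (-1 : ℝ) 1) : |a y - a z| ≤ L * |y - z| :=
  abs_sub_le_of_hasDerivAt h.cont h.deriv (fun y hy => h.bound1 y (Ioo_subset_Icc_self hy)) hy hz

theorem Convection.abs_le {L : ℝ} {a a1 : ℝ → ℝ} (h : Convection L a a1) {y : ℝ}
    (hy : y ∈ Icc (-1 : ℝ) 1) : |a y| ≤ L * |y| := by
  simpa [h.zero] using h.lip hy (show (0 : ℝ) ∈ Icc (-1 : ℝ) 1 by simp)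

theorem Convection.nonneg {L : ℝ} {a a1 : ℝ → ℝ} (h : Convection L a a1) : 0 ≤ L :=
  (abs_nonneg _).trans (h.bound1 0 (by simp))

/-! ### The smooth substitute for the cell means of `a (uI - u)` -/

/-- `a ψ² u'' / 12`, where `ψ = (κ / α) (η + |y|)^{1-α}` is the local mesh width. -/
noncomputable def meanDensity (α η κ : ℝ) (a u2 : ℝ → ℝ) (y : ℝ) : ℝ :=
  (κ / α) ^ 2 / 12 * (a y * (η + |y|) ^ (2 - 2 * α) * u2 y)

/-- The derivative of `meanDensity` away from the origin. -/
noncomputable def meanDensityDeriv (α η κ : ℝ) (a a1 u2 u3 : ℝ → ℝ) (y : ℝ) : ℝ :=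
  (κ / α) ^ 2 / 12 *
    ((a1 y * (η + |y|) ^ (2 - 2 * α)
      + a y * ((SignType.sign y : ℝ) * (2 - 2 * α) * (η + |y|) ^ (1 - 2 * α))) * u2 y
      + a y * (η + |y|) ^ (2 - 2 * α) * u3 y)

section MeanDensity

variable {α lam Cu L η κ : ℝ} {a a1 u u1 u2 u3 : ℝ → ℝ}

theorem continuous_layer_rpow (hη : 0 < η) (b : ℝ) : Continuous fun y : ℝ => (η + |y|) ^ b :=
  (continuous_const.add continuous_abs).rpow_const fun y =>
    Or.inl (add_pos_of_pos_of_nonneg hη (abs_nonneg y)).ne'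

theorem continuousOn_meanDensity (hη : 0 < η) (ha : Convection L a a1)
    (hu : LayerFunction lam Cu η u u1 u2 u3) :
    ContinuousOn (meanDensity α η κ a u2) (Icc (-1) 1) :=
  continuousOn_const.mul ((ha.cont.mul (continuous_layer_rpow hη _).continuousOn).mul hu.cont2)

theorem hasDerivAt_meanDensity (hη : 0 < η) (ha : Convection L a a1)
    (hu : LayerFunction lam Cu η u u1 u2 u3) {y : ℝ} (hy : y ∈ Ioo (-1 : ℝ) 1) (hy0 : y ≠ 0) :
    HasDerivAt (meanDensity α η κ a u2) (meanDensityDeriv α η κ a a1 u2 u3 y) y := by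
  have hs : HasDerivAt (fun y : ℝ => (η + |y|) ^ (2 - 2 * α))
      ((SignType.sign y : ℝ) * (2 - 2 * α) * (η + |y|) ^ (2 - 2 * α - 1)) y :=
    ((hasDerivAt_abs hy0).const_add η).rpow_const
      (Or.inl (add_pos_of_pos_of_nonneg hη (abs_nonneg y)).ne')
  rw [show 2 - 2 * α - 1 = 1 - 2 * α by ring] at hs
  exact (((ha.deriv y hy).mul hs).mul (hu.deriv2 y hy)).const_mul _

theorem abs_meanDensityDeriv_le (hα0 : 0 < α) (hα : α ≤ 1 / 4) (hαl : α ≤ lam / 2)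
    (hlam : lam < 2) (hCu : 0 < Cu) (hη : 0 < η) (hη1 : η ≤ 1) (ha : Convection L a a1)
    (hu : LayerFunction lam Cu η u u1 u2 u3) {y : ℝ} (hy : y ∈ Icc (-1 : ℝ) 1) :
    |meanDensityDeriv α η κ a a1 u2 u3 y| ≤ 4 * L * Cu * (κ / α) ^ 2 := by
  have hs : 0 < η + |y| := by positivity
  have hs2 : η + |y| ≤ 2 := by linarith [abs_le.2 hy]
  have hL := ha.nonneg
  have hys : |y| ≤ η + |y| := by linarith
  have hA : |a y| ≤ L * (η + |y|) := (ha.abs_le hy).trans (mul_le_mul_of_nonneg_left hys hL)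
  have hA1 := ha.bound1 y hy
  have hU2 := hu.bound2 y hy
  have hU3 := hu.bound3 y hy
  set s := η + |y| with hsdef
  have hw := weight_le hs hs2 hα0 hα hαl hlam
  have hp1 : 0 < s ^ (1 - 2 * α) := Real.rpow_pos_of_pos hs _
  have hp2 : 0 < s ^ (2 - 2 * α) := Real.rpow_pos_of_pos hs _
  have hq2 : 0 < s ^ (lam - 2) := Real.rpow_pos_of_pos hs _
  have hss : s * s ^ (1 - 2 * α) = s ^ (2 - 2 * α) := by
    rw [show 2 - 2 * α = 1 + (1 - 2 * α) by ring, Real.rpow_add hs, Real.rpow_one]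
  have hsgn : |(SignType.sign y : ℝ)| ≤ 1 := by
    rcases lt_trichotomy y 0 with h | h | h <;> simp [h]
  have b1 : |a1 y * s ^ (2 - 2 * α)| ≤ L * s ^ (2 - 2 * α) := by
    rw [abs_mul, abs_of_pos hp2]; gcongr
  have b2 : |a y * ((SignType.sign y : ℝ) * (2 - 2 * α) * s ^ (1 - 2 * α))|
      ≤ 2 * L * s ^ (2 - 2 * α) := by
    rw [abs_mul, abs_mul, abs_mul, abs_of_pos hp1, abs_of_pos (by linarith : 0 < 2 - 2 * α)]
    calc |a y| * (|(SignType.sign y : ℝ)| * (2 - 2 * α) * s ^ (1 - 2 * α))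
        ≤ L * s * (1 * 2 * s ^ (1 - 2 * α)) := by
          have : 0 ≤ 2 - 2 * α := by linarith
          gcongr
          linarith
      _ = 2 * L * (s * s ^ (1 - 2 * α)) := by ring
      _ = _ := by rw [hss]
  have b3 : |(a1 y * s ^ (2 - 2 * α)
      + a y * ((SignType.sign y : ℝ) * (2 - 2 * α) * s ^ (1 - 2 * α))) * u2 y|
      ≤ 24 * L * Cu := by
    rw [abs_mul]
    calc _ ≤ (L * s ^ (2 - 2 * α) + 2 * L * s ^ (2 - 2 * α)) * (Cu * (1 + s ^ (lam - 2))) := by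
          gcongr
          exact (abs_add_le _ _).trans (add_le_add b1 b2)
      _ = 3 * L * Cu * (s ^ (2 - 2 * α) * (1 + s ^ (lam - 2))) := by ring
      _ ≤ 3 * L * Cu * 8 := by gcongr
      _ = _ := by ring
  have b4 : |a y * s ^ (2 - 2 * α) * u3 y| ≤ 16 * L * Cu := by
    rw [abs_mul, abs_mul, abs_of_pos hp2]
    calc _ ≤ L * s * s ^ (2 - 2 * α) * (Cu * (1 + s ^ (lam - 3))) := by gcongr
      _ = L * Cu * s ^ (2 - 2 * α) * (s * (1 + s ^ (lam - 3))) := by ring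
      _ ≤ L * Cu * s ^ (2 - 2 * α) * (2 * (1 + s ^ (lam - 2))) :=
          mul_le_mul_of_nonneg_left (mul_third_le hs hs2) (by positivity)
      _ = 2 * L * Cu * (s ^ (2 - 2 * α) * (1 + s ^ (lam - 2))) := by ring
      _ ≤ 2 * L * Cu * 8 := by gcongr
      _ = _ := by ring
  rw [meanDensityDeriv, abs_mul, abs_of_nonneg (by positivity)]
  calc _ ≤ (κ / α) ^ 2 / 12 * (24 * L * Cu + 16 * L * Cu) := by
        gcongr; exact (abs_add_le _ _).trans (add_le_add b3 b4)
    _ ≤ 4 * L * Cu * (κ / α) ^ 2 := by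
        have : 0 ≤ L * Cu * (κ / α) ^ 2 := by positivity
        linarith

end MeanDensity

/-! ### Estimates on a single cell -/

section Cell

variable {α lam Cu L η κ p q s0 s1 : ℝ} {a a1 u u1 u2 u3 uI : ℝ → ℝ}

theorem MeshCell.subset (hC : MeshCell α η κ p q s0 s1) : Icc p q ⊆ Icc (-1) 1 :=
  Icc_subset_Icc hC.left hC.right

theorem MeshCell.subset' (hC : MeshCell α η κ p q s0 s1) : Ioo p q ⊆ Ioo (-1) 1 :=
  Ioo_subset_Ioo hC.left hC.right

theorem MeshCell.kappa_pos (hα0 : 0 < α) (hC : MeshCell α η κ p q s0 s1) : 0 < κ := by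
  rw [← hC.rpow_sub, sub_pos]
  exact Real.rpow_lt_rpow hC.pos.le (by linarith [hC.sub, hC.lt]) hα0

/-- The width of a cell lies between the values of the local mesh width at its ends. -/
theorem MeshCell.width_bounds (hα0 : 0 < α) (hα : α ≤ 1 / 4) (hC : MeshCell α η κ p q s0 s1) :
    κ / α * s0 ^ (1 - α) ≤ q - p ∧ q - p ≤ κ / α * s1 ^ (1 - α) := by
  have hlt : s0 < s1 := by linarith [hC.sub, hC.lt]
  have hκ := hC.kappa_pos hα0
  obtain ⟨z, hz, hze⟩ := exists_hasDerivAt_eq_slope (fun s : ℝ => s ^ α)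
    (fun s => α * s ^ (α - 1)) hlt
    (fun s hs => (Real.continuousAt_rpow_const s α
      (Or.inl (hC.pos.trans_le hs.1).ne')).continuousWithinAt)
    (fun s hs => Real.hasDerivAt_rpow_const (Or.inl (hC.pos.trans hs.1).ne'))
  have hz0 : 0 < z := hC.pos.trans hz.1
  have e1 : α * z ^ (α - 1) * (q - p) = κ := by
    rw [hze, hC.sub, ← hC.rpow_sub]
    field_simp [(sub_pos.2 hC.lt).ne']
  have e2 : z ^ (α - 1) * z ^ (1 - α) = 1 := by
    rw [← Real.rpow_add hz0]; simp
  have e3 : q - p = κ / α * z ^ (1 - α) := by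
    rw [← e1]
    field_simp
    linear_combination (-(q - p)) * e2
  rw [e3]
  constructor
  · gcongr
    · exact hC.pos.le
    · linarith
    · exact hz.1.le
  · gcongr
    · linarith
    · exact hz.2.le

theorem MeshCell.ratio (hα0 : 0 < α) (hC : MeshCell α η κ p q s0 s1) (hreg : κ ≤ s0 ^ α) :
    s1 ≤ 2 ^ (1 / α) * s0 := by
  have h1 : s1 ^ α ≤ 2 * s0 ^ α := by linarith [hC.rpow_sub]
  have hs1 : 0 < s1 := by linarith [hC.sub, hC.lt, hC.pos]
  have e : (2 ^ (1 / α) * s0) ^ α = 2 * s0 ^ α := by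
    rw [Real.mul_rpow (by positivity) hC.pos.le, ← Real.rpow_mul (by norm_num),
      one_div_mul_cancel hα0.ne', Real.rpow_one]
  rw [← e] at h1
  exact (Real.rpow_le_rpow_iff hs1.le (by have := hC.pos; positivity) hα0).1 h1

/-- In a regular cell the local mesh width at the two ends is comparable. -/
theorem MeshCell.width_ratio (hα0 : 0 < α) (hα : α ≤ 1 / 4) (hC : MeshCell α η κ p q s0 s1)
    (hreg : κ ≤ s0 ^ α) :
    s1 ^ (1 - α) ≤ 2 ^ (1 / α) * s0 ^ (1 - α) := by
  have hs1 : 0 < s1 := by linarith [hC.sub, hC.lt, hC.pos]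
  have hR : (1 : ℝ) ≤ 2 ^ (1 / α) := Real.one_le_rpow (by norm_num) (by positivity)
  calc s1 ^ (1 - α) ≤ (2 ^ (1 / α) * s0) ^ (1 - α) :=
        Real.rpow_le_rpow hs1.le (hC.ratio hα0 hreg) (by linarith)
    _ = (2 ^ (1 / α)) ^ (1 - α) * s0 ^ (1 - α) := Real.mul_rpow (by positivity) hC.pos.le
    _ ≤ 2 ^ (1 / α) * s0 ^ (1 - α) := by
        gcongr
        · exact Real.rpow_nonneg hC.pos.le _
        · exact Real.rpow_le_self_of_one_le hR (by linarith)

theorem rpow_sq_eq (hs : 0 < s0) : (s0 ^ (1 - α)) ^ 2 = s0 ^ (2 - 2 * α) := by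
  rw [← Real.rpow_natCast, ← Real.rpow_mul hs.le]; push_cast; ring_nf

theorem MeshCell.abs_second_le (hlam : lam < 2) (hCu : 0 < Cu)
    (hC : MeshCell α η κ p q s0 s1) (hu : LayerFunction lam Cu η u u1 u2 u3) {y : ℝ}
    (hy : y ∈ Icc p q) : |u2 y| ≤ Cu * (1 + s0 ^ (lam - 2)) := by
  refine (hu.bound2 y (hC.subset hy)).trans ?_
  have := Real.rpow_le_rpow_of_nonpos hC.pos (hC.lower y hy) (by linarith : lam - 2 ≤ 0)
  gcongr

theorem MeshCell.abs_third_le (hlam : lam < 2) (hCu : 0 < Cu)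
    (hC : MeshCell α η κ p q s0 s1) (hu : LayerFunction lam Cu η u u1 u2 u3) {y : ℝ}
    (hy : y ∈ Icc p q) : |u3 y| ≤ Cu * (1 + s0 ^ (lam - 3)) := by
  refine (hu.bound3 y (hC.subset hy)).trans ?_
  have := Real.rpow_le_rpow_of_nonpos hC.pos (hC.lower y hy) (by linarith : lam - 3 ≤ 0)
  gcongr

theorem MeshCell.width_sq_mul_le (hα0 : 0 < α) (hα : α ≤ 1 / 4) (hαl : α ≤ lam / 2)
    (hlam : lam < 2) (hCu : 0 < Cu) (hC : MeshCell α η κ p q s0 s1) (hreg : κ ≤ s0 ^ α) :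
    (q - p) ^ 2 * (Cu * (1 + s0 ^ (lam - 2))) ≤ 8 * Cu * (2 ^ (1 / α)) ^ 2 * (κ / α) ^ 2 := by
  have hκ := hC.kappa_pos hα0
  have hs0 := hC.pos
  have h1 : q - p ≤ κ / α * (2 ^ (1 / α) * s0 ^ (1 - α)) :=
    (hC.width_bounds hα0 hα).2.trans (by gcongr; exact hC.width_ratio hα0 hα hreg)
  have h2 := weight_le hs0 (by linarith [hC.sub, hC.lt, hC.le_two]) hα0 hα hαl hlam
  have h0 : 0 ≤ q - p := (sub_pos.2 hC.lt).le
  calc (q - p) ^ 2 * (Cu * (1 + s0 ^ (lam - 2)))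
      ≤ (κ / α * (2 ^ (1 / α) * s0 ^ (1 - α))) ^ 2 * (Cu * (1 + s0 ^ (lam - 2))) := by gcongr
    _ = (κ / α) ^ 2 * (2 ^ (1 / α)) ^ 2 * Cu * ((s0 ^ (1 - α)) ^ 2 * (1 + s0 ^ (lam - 2))) := by
        ring
    _ = (κ / α) ^ 2 * (2 ^ (1 / α)) ^ 2 * Cu * (s0 ^ (2 - 2 * α) * (1 + s0 ^ (lam - 2))) := by
        rw [rpow_sq_eq hs0]
    _ ≤ (κ / α) ^ 2 * (2 ^ (1 / α)) ^ 2 * Cu * 8 := by gcongr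
    _ = _ := by ring

/-- Interpolation error on a regular cell. -/
theorem MeshCell.abs_error_le (hα0 : 0 < α) (hα : α ≤ 1 / 4) (hαl : α ≤ lam / 2)
    (hlam : lam < 2) (hCu : 0 < Cu) (hC : MeshCell α η κ p q s0 s1) (hreg : κ ≤ s0 ^ α)
    (hu : LayerFunction lam Cu η u u1 u2 u3) {k : ℝ}
    (hI : ∀ y ∈ Icc p q, uI y = uI p + k * (y - p)) (hIp : uI p = u p) (hIq : uI q = u q)
    {y : ℝ} (hy : y ∈ Icc p q) :
    |uI y - u y| ≤ 8 * Cu * (2 ^ (1 / α)) ^ 2 * (κ / α) ^ 2 := by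
  have hcI : ContinuousOn uI (Icc p q) :=
    ContinuousOn.congr (f := fun y => uI p + k * (y - p)) (by fun_prop) hI
  have := abs_le_of_zero_ends (w := fun y => uI y - u y) (w1 := fun y => k - u1 y)
    (w2 := fun y => - u2 y) (D := Cu * (1 + s0 ^ (lam - 2))) hC.lt
    (hcI.sub (hu.cont.mono hC.subset)) (continuousOn_const.sub (hu.cont1.mono hC.subset))
    (fun y hy => (hasDerivAt_of_affine hI hy).sub (hu.deriv y (hC.subset' hy)))
    (fun y hy => (hu.deriv1 y (hC.subset' hy)).const_sub k)
    (fun y hy => by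
      rw [abs_neg]; exact hC.abs_second_le hlam hCu hu (Ioo_subset_Icc_self hy))
    (by simp [hIp]) (by simp [hIq]) hy
  refine this.trans ?_
  rw [mul_comm]
  exact hC.width_sq_mul_le hα0 hα hαl hlam hCu hreg

/-- Second order expansion of the interpolation error. -/
theorem MeshCell.abs_error_sub_le (hlam : lam < 2) (hCu : 0 < Cu)
    (hC : MeshCell α η κ p q s0 s1)
    (hu : LayerFunction lam Cu η u u1 u2 u3) {k : ℝ}
    (hI : ∀ y ∈ Icc p q, uI y = uI p + k * (y - p)) (hIp : uI p = u p) (hIq : uI q = u q)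
    {y : ℝ} (hy : y ∈ Icc p q) :
    |uI y - u y - u2 p / 2 * ((y - p) * (q - y))|
      ≤ Cu * (1 + s0 ^ (lam - 3)) * (q - p) ^ 3 := by
  have hcI : ContinuousOn uI (Icc p q) :=
    ContinuousOn.congr (f := fun y => uI p + k * (y - p)) (by fun_prop) hI
  have hd3 : ∀ y ∈ Ioo p q, |u3 y| ≤ Cu * (1 + s0 ^ (lam - 3)) := fun y hy =>
    hC.abs_third_le hlam hCu hu (Ioo_subset_Icc_self hy)
  have hpm : p ∈ Icc p q := left_mem_Icc.2 hC.lt.le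
  have hD : 0 ≤ Cu * (1 + s0 ^ (lam - 3)) := (abs_nonneg _).trans (hC.abs_third_le hlam hCu hu hpm)
  have := abs_le_of_zero_ends (w := fun y => uI y - u y - u2 p / 2 * ((y - p) * (q - y)))
    (w1 := fun y => k - u1 y - u2 p / 2 * (1 * (q - y) + (y - p) * (-1)))
    (w2 := fun y => - u2 y - u2 p / 2 * (1 * (-1) + 1 * (-1)))
    (D := Cu * (1 + s0 ^ (lam - 3)) * (q - p)) hC.lt
    ((hcI.sub (hu.cont.mono hC.subset)).sub (by fun_prop))
    ((continuousOn_const.sub (hu.cont1.mono hC.subset)).sub (by fun_prop))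
    (fun y hy => ((hasDerivAt_of_affine hI hy).sub (hu.deriv y (hC.subset' hy))).sub
      ((((hasDerivAt_id y).sub_const p).mul ((hasDerivAt_id y).const_sub q)).const_mul _))
    (fun y hy => ((hu.deriv1 y (hC.subset' hy)).const_sub k).sub
      (((((hasDerivAt_id y).const_sub q).const_mul 1).add
        (((hasDerivAt_id y).sub_const p).mul_const (-1))).const_mul _))
    (fun y hy => by
      have h := abs_sub_le_of_hasDerivAt (hu.cont2.mono hC.subset)
        (fun y hy => hu.deriv2 y (hC.subset' hy)) hd3 hpm (Ioo_subset_Icc_self hy)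
      rw [show -u2 y - u2 p / 2 * (1 * (-1) + 1 * (-1)) = u2 p - u2 y by ring]
      refine h.trans (mul_le_mul_of_nonneg_left ?_ hD)
      rw [abs_le]; constructor <;> linarith [hy.1, hy.2])
    (by simp [hIp]) (by simp [hIq]) hy
  exact this.trans_eq (by ring)

end Cell

section CellIntegral

variable {α lam Cu L η κ p q s0 s1 : ℝ} {a a1 u u1 u2 u3 uI : ℝ → ℝ}

/-- The local mesh width varies little over a regular cell. -/
theorem MeshCell.width_variation (hα0 : 0 < α) (hα : α ≤ 1 / 4)
    (hC : MeshCell α η κ p q s0 s1) (hreg : κ ≤ s0 ^ α) {y : ℝ} (hy : y ∈ Icc p q) :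
    s0 * |(q - p) ^ 2 - (κ / α * (η + |y|) ^ (1 - α)) ^ 2|
      ≤ 2 * 2 ^ (1 / α) * (q - p) * ((κ / α) ^ 2 * s0 ^ (2 - 2 * α)) := by
  have hκ := hC.kappa_pos hα0
  have hs0 := hC.pos
  have hh : 0 < q - p := sub_pos.2 hC.lt
  have hs1 : 0 < s1 := by linarith [hC.sub]
  have hb := hC.width_bounds hα0 hα
  have hr := hC.width_ratio hα0 hα hreg
  have hκα : 0 < κ / α := by positivity
  have h1 : s0 ^ (1 - α) ≤ (η + |y|) ^ (1 - α) :=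
    Real.rpow_le_rpow hs0.le (hC.lower y hy) (by linarith)
  have h2 : (η + |y|) ^ (1 - α) ≤ s1 ^ (1 - α) :=
    Real.rpow_le_rpow (hs0.le.trans (hC.lower y hy)) (hC.upper y hy) (by linarith)
  have h3 : s0 * (s1 ^ (1 - α) - s0 ^ (1 - α)) ≤ (q - p) * s0 ^ (1 - α) := by
    have e1 : s1 ^ (1 - α) = s1 * s1 ^ (-α) := by
      rw [sub_eq_add_neg, Real.rpow_add hs1, Real.rpow_one]
    have e2 : s0 ^ (1 - α) = s0 * s0 ^ (-α) := by
      rw [sub_eq_add_neg, Real.rpow_add hs0, Real.rpow_one]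
    have e3 : s1 ^ (-α) ≤ s0 ^ (-α) :=
      Real.rpow_le_rpow_of_nonpos hs0 (by linarith [hC.sub]) (by linarith)
    have e4 : s1 * s1 ^ (-α) ≤ s1 * s0 ^ (-α) := mul_le_mul_of_nonneg_left e3 hs1.le
    rw [e1, e2, ← hC.sub]
    calc _ ≤ s0 * (s1 * s0 ^ (-α) - s0 * s0 ^ (-α)) := by gcongr
      _ = _ := by ring
  have hp0 : 0 < s0 ^ (1 - α) := Real.rpow_pos_of_pos hs0 _
  set P := (η + |y|) ^ (1 - α) with hP
  have d1 : |(q - p) - κ / α * P| ≤ κ / α * (s1 ^ (1 - α) - s0 ^ (1 - α)) := by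
    have := mul_le_mul_of_nonneg_left h1 hκα.le
    have := mul_le_mul_of_nonneg_left h2 hκα.le
    rw [abs_le]; constructor <;> linarith [hb.1, hb.2]
  have d2 : |(q - p) + κ / α * P| ≤ 2 * (κ / α * (2 ^ (1 / α) * s0 ^ (1 - α))) := by
    have := mul_le_mul_of_nonneg_left (h2.trans hr) hκα.le
    have := mul_le_mul_of_nonneg_left hr hκα.le
    have : 0 ≤ κ / α * P := mul_nonneg hκα.le (hp0.le.trans h1)
    rw [abs_of_nonneg (by linarith)]
    linarith [hb.2]
  have e : (q - p) ^ 2 - (κ / α * P) ^ 2 = ((q - p) - κ / α * P) * ((q - p) + κ / α * P) := by ring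
  rw [e, abs_mul, ← rpow_sq_eq hs0]
  calc _ ≤ s0 * ((κ / α * (s1 ^ (1 - α) - s0 ^ (1 - α)))
        * (2 * (κ / α * (2 ^ (1 / α) * s0 ^ (1 - α))))) := by
        refine mul_le_mul_of_nonneg_left ?_ hs0.le
        exact mul_le_mul d1 d2 (abs_nonneg _) ((abs_nonneg _).trans d1)
    _ = (s0 * (s1 ^ (1 - α) - s0 ^ (1 - α)))
        * (2 * (κ / α) ^ 2 * 2 ^ (1 / α) * s0 ^ (1 - α)) := by ring
    _ ≤ ((q - p) * s0 ^ (1 - α)) * (2 * (κ / α) ^ 2 * 2 ^ (1 / α) * s0 ^ (1 - α)) := by gcongr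
    _ = _ := by ring

theorem integral_bubble (A : ℝ) :
    ∫ y in p..q, A * ((y - p) * (q - y)) = A * ((q - p) ^ 3 / 6) := by
  rw [intervalIntegral.integral_const_mul]
  congr 1
  have := intervalIntegral.integral_eq_sub_of_hasDerivAt
    (f := fun y => (q - p) * (y - p) ^ 2 / 2 - (y - p) ^ 3 / 3)
    (f' := fun y => (y - p) * (q - y)) (a := p) (b := q) ?_ ?_
  · rw [this]; ring
  · intro y _
    have e2 : HasDerivAt (fun y : ℝ => y - p) 1 y := (hasDerivAt_id y).sub_const p
    have := (((e2.pow 2).const_mul (q - p)).div_const 2).sub ((e2.pow 3).div_const 3)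
    refine this.congr_deriv ?_
    simp only [Nat.cast_ofNat]
    ring
  · apply Continuous.intervalIntegrable; fun_prop

theorem MeshCell.abs_integral_le_of_regular (hα0 : 0 < α) (hα : α ≤ 1 / 4) (hαl : α ≤ lam / 2)
    (hlam : lam < 2) (hCu : 0 < Cu) (hη : 0 < η) (hη1 : η ≤ 1)
    (hC : MeshCell α η κ p q s0 s1) (hreg : κ ≤ s0 ^ α) (ha : Convection L a a1)
    (hu : LayerFunction lam Cu η u u1 u2 u3) {k : ℝ}
    (hI : ∀ y ∈ Icc p q, uI y = uI p + k * (y - p)) (hIp : uI p = u p) (hIq : uI q = u q) :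
    |∫ y in p..q, (a y * (uI y - u y) - meanDensity α η κ a u2 y)|
      ≤ 5 * L * 2 ^ (1 / α) * (8 * Cu * (2 ^ (1 / α)) ^ 2 * (κ / α) ^ 2) * (q - p) ^ 2 := by
  have hh : 0 < q - p := sub_pos.2 hC.lt
  have hs0 := hC.pos
  have hL := ha.nonneg
  have hpm : p ∈ Icc p q := left_mem_Icc.2 hC.lt.le
  have hR : (1 : ℝ) ≤ 2 ^ (1 / α) := Real.one_le_rpow (by norm_num) (by positivity)
  have hcI : ContinuousOn uI (Icc p q) :=
    ContinuousOn.congr (f := fun y => uI p + k * (y - p)) (by fun_prop) hI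
  have herr := fun y (hy : y ∈ Icc p q) =>
    hC.abs_error_le hα0 hα hαl hlam hCu hreg hu hI hIp hIq hy
  have hwid := hC.width_sq_mul_le hα0 hα hαl hlam hCu hreg
  have hvar := hC.width_variation hα0 hα hreg hpm
  have hratio := hC.ratio hα0 hreg
  have hwt := weight_le hs0 (by linarith [hC.sub, hC.le_two]) hα0 hα hαl hlam
  have hU2 := hC.abs_second_le hlam hCu hu hpm
  set R : ℝ := 2 ^ (1 / α) with hRdef
  set B : ℝ := (κ / α) ^ 2 with hB
  have hB0 : 0 ≤ B := sq_nonneg _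
  set W : ℝ := 8 * Cu * R ^ 2 * B with hW
  have hW0 : 0 ≤ W := by positivity
  have hap : |a p| ≤ L * (R * s0) := by
    refine (ha.abs_le (hC.subset hpm)).trans (mul_le_mul_of_nonneg_left ?_ hL)
    linarith [hC.upper p hpm]
  have hq2 : 0 < s0 ^ (lam - 2) := Real.rpow_pos_of_pos hs0 _
  have hq3 : 0 < s0 ^ (lam - 3) := Real.rpow_pos_of_pos hs0 _
  have hcG : ContinuousOn (meanDensity α η κ a u2) (Icc p q) :=
    (continuousOn_meanDensity hη ha hu).mono hC.subset
  have hG : ∀ y ∈ Icc p q, |meanDensity α η κ a u2 y - meanDensity α η κ a u2 p|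
      ≤ 4 * L * Cu * B * (q - p) := by
    intro y hy
    refine (abs_sub_le_of_hasDerivAt (w' := meanDensityDeriv α η κ a a1 u2 u3)
      (D := 4 * L * Cu * B) hcG (fun z hz => hasDerivAt_meanDensity hη ha hu (hC.subset' hz) ?_)
      (fun z hz => abs_meanDensityDeriv_le hα0 hα hαl hlam hCu hη hη1 ha hu
        (Ioo_subset_Icc_self (hC.subset' hz))) hy hpm).trans ?_
    · rintro rfl
      rcases hC.side with h | h
      · exact absurd hz.1 (not_lt.2 h)
      · exact absurd hz.2 (not_lt.2 h)
    · refine mul_le_mul_of_nonneg_left ?_ (by positivity)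
      rw [abs_le]; constructor <;> linarith [hy.1, hy.2]
  have hpt : ∀ y ∈ Icc p q, |a y * (uI y - u y) - a p * (u2 p / 2 * ((y - p) * (q - y)))|
      ≤ (L + 2 * L * R) * W * (q - p) := by
    intro y hy
    have e : a y * (uI y - u y) - a p * (u2 p / 2 * ((y - p) * (q - y)))
        = (a y - a p) * (uI y - u y)
          + a p * (uI y - u y - u2 p / 2 * ((y - p) * (q - y))) := by ring
    have h1 : |(a y - a p) * (uI y - u y)| ≤ L * (q - p) * W := by
      rw [abs_mul]
      refine mul_le_mul ((ha.lip (hC.subset hy) (hC.subset hpm)).trans ?_) (herr y hy)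
        (abs_nonneg _) (by positivity)
      refine mul_le_mul_of_nonneg_left ?_ hL
      rw [abs_le]; constructor <;> linarith [hy.1, hy.2]
    have h2 : |a p * (uI y - u y - u2 p / 2 * ((y - p) * (q - y)))| ≤ 2 * L * R * W * (q - p) := by
      rw [abs_mul]
      calc _ ≤ L * (R * s0) * (Cu * (1 + s0 ^ (lam - 3)) * (q - p) ^ 3) :=
            mul_le_mul hap (hC.abs_error_sub_le hlam hCu hu hI hIp hIq hy) (abs_nonneg _)
              (by positivity)
        _ = L * R * Cu * (q - p) ^ 3 * (s0 * (1 + s0 ^ (lam - 3))) := by ring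
        _ ≤ L * R * Cu * (q - p) ^ 3 * (2 * (1 + s0 ^ (lam - 2))) :=
            mul_le_mul_of_nonneg_left
              (mul_third_le hs0 (by linarith [hC.sub, hC.le_two])) (by positivity)
        _ = 2 * L * R * (q - p) * ((q - p) ^ 2 * (Cu * (1 + s0 ^ (lam - 2)))) := by ring
        _ ≤ 2 * L * R * (q - p) * W := mul_le_mul_of_nonneg_left hwid (by positivity)
        _ = _ := by ring
    rw [e]
    refine (abs_add_le _ _).trans ((add_le_add h1 h2).trans_eq (by ring))
  have hmain : |∫ y in p..q, ((a y * (uI y - u y) - a p * (u2 p / 2 * ((y - p) * (q - y))))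
      - (meanDensity α η κ a u2 y - meanDensity α η κ a u2 p))|
      ≤ ((L + 2 * L * R) * W * (q - p) + 4 * L * Cu * B * (q - p)) * (q - p) := by
    have := intervalIntegral.norm_integral_le_of_norm_le_const (a := p) (b := q)
      (f := fun y => ((a y * (uI y - u y) - a p * (u2 p / 2 * ((y - p) * (q - y))))
        - (meanDensity α η κ a u2 y - meanDensity α η κ a u2 p)))
      (C := (L + 2 * L * R) * W * (q - p) + 4 * L * Cu * B * (q - p)) ?_
    · rwa [abs_of_pos hh, Real.norm_eq_abs] at this
    · intro y hy
      rw [uIoc_of_le hC.lt.le] at hy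
      have hy' := Ioc_subset_Icc_self hy
      exact (abs_sub _ _).trans (add_le_add (hpt y hy') (hG y hy'))
  have hrest : |a p * (u2 p / 2) * ((q - p) ^ 3 / 6) - (q - p) * meanDensity α η κ a u2 p|
      ≤ L * W * (q - p) ^ 2 / 6 := by
    have hsp : 0 < η + |p| := hs0.trans_le (hC.lower p hpm)
    have e : a p * (u2 p / 2) * ((q - p) ^ 3 / 6) - (q - p) * meanDensity α η κ a u2 p
        = a p * (u2 p * (((q - p) ^ 2 - (κ / α * (η + |p|) ^ (1 - α)) ^ 2) * ((q - p) / 12))) := by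
      rw [meanDensity, mul_pow, rpow_sq_eq hsp]; ring
    rw [e, abs_mul, abs_mul, abs_mul, abs_of_pos (by positivity : 0 < (q - p) / 12)]
    set Δ := |(q - p) ^ 2 - (κ / α * (η + |p|) ^ (1 - α)) ^ 2| with hΔ
    have hΔ0 : 0 ≤ Δ := abs_nonneg _
    calc _ ≤ L * (R * s0) * (Cu * (1 + s0 ^ (lam - 2)) * (Δ * ((q - p) / 12))) := by gcongr
      _ = L * R * (Cu * (1 + s0 ^ (lam - 2))) * ((q - p) / 12) * (s0 * Δ) := by ring
      _ ≤ L * R * (Cu * (1 + s0 ^ (lam - 2))) * ((q - p) / 12)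
          * (2 * R * (q - p) * (B * s0 ^ (2 - 2 * α))) := by gcongr
      _ = L * R ^ 2 * Cu * (q - p) ^ 2 / 6 * B * (s0 ^ (2 - 2 * α) * (1 + s0 ^ (lam - 2))) := by
          ring
      _ ≤ L * R ^ 2 * Cu * (q - p) ^ 2 / 6 * B * 8 := by gcongr
      _ = _ := by rw [hW]; ring
  have hsplit : ∫ y in p..q, (a y * (uI y - u y) - meanDensity α η κ a u2 y)
      = (∫ y in p..q, ((a y * (uI y - u y) - a p * (u2 p / 2 * ((y - p) * (q - y))))
        - (meanDensity α η κ a u2 y - meanDensity α η κ a u2 p)))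
        + (a p * (u2 p / 2) * ((q - p) ^ 3 / 6) - (q - p) * meanDensity α η κ a u2 p) := by
    have hsub : uIcc p q = Icc p q := uIcc_of_le hC.lt.le
    have i1 : IntervalIntegrable (fun y => (a y * (uI y - u y)
        - a p * (u2 p / 2 * ((y - p) * (q - y))))
        - (meanDensity α η κ a u2 y - meanDensity α η κ a u2 p)) volume p q := by
      apply ContinuousOn.intervalIntegrable
      rw [hsub]
      exact (((ha.cont.mono hC.subset).mul (hcI.sub (hu.cont.mono hC.subset))).sub
        (by fun_prop)).sub (hcG.sub continuousOn_const)
    have i2 : IntervalIntegrable (fun y => a p * (u2 p / 2) * ((y - p) * (q - y))) volume p q := by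
      apply Continuous.intervalIntegrable; fun_prop
    rw [← integral_bubble, ← smul_eq_mul (q - p), ← intervalIntegral.integral_const,
      ← intervalIntegral.integral_sub i2 intervalIntegrable_const,
      ← intervalIntegral.integral_add i1 (i2.sub intervalIntegrable_const)]
    refine intervalIntegral.integral_congr fun y _ => ?_
    ring
  rw [hsplit]
  refine (abs_add_le _ _).trans ((add_le_add hmain hrest).trans ?_)
  have hR2 : (1 : ℝ) ≤ R ^ 2 := one_le_pow₀ hR
  have hX : 0 ≤ L * (q - p) ^ 2 := by positivity
  have h4 : 4 * Cu * B ≤ W / 2 := by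
    have : 0 ≤ 4 * Cu * B := by positivity
    have := mul_le_mul_of_nonneg_left hR2 this
    rw [hW]; linarith
  have h5 : W ≤ R * W := by
    have := mul_le_mul_of_nonneg_right hR hW0
    linarith
  calc _ = L * (q - p) ^ 2 * (W + 2 * (R * W) + 4 * Cu * B + W / 6) := by ring
    _ ≤ L * (q - p) ^ 2 * (5 * (R * W)) := by gcongr; linarith
    _ = _ := by ring

/-- A function whose derivative is dominated by that of `g` varies no more than `g`. -/
theorem abs_sub_le_of_dominated {w w' g g' : ℝ → ℝ} (hpq : p < q)
    (hw : ContinuousOn w (Icc p q)) (hg : ContinuousOn g (Icc p q))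
    (hdw : ∀ y ∈ Ioo p q, HasDerivAt w (w' y) y) (hdg : ∀ y ∈ Ioo p q, HasDerivAt g (g' y) y)
    (h : ∀ y ∈ Ioo p q, |w' y| ≤ g' y) {y z : ℝ} (hy : y ∈ Icc p q) (hz : z ∈ Icc p q) :
    |w y - w z| ≤ g q - g p := by
  have m1 : MonotoneOn (fun x => g x - w x) (Icc p q) := by
    refine monotoneOn_of_deriv_nonneg (convex_Icc p q) (hg.sub hw) ?_ ?_ <;>
      rw [interior_Icc] <;> intro x hx
    · exact ((hdg x hx).sub (hdw x hx)).differentiableAt.differentiableWithinAt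
    · have hd : HasDerivAt (fun x => g x - w x) (g' x - w' x) x := (hdg x hx).sub (hdw x hx)
      rw [hd.deriv]
      linarith [le_abs_self (w' x), h x hx]
  have m2 : MonotoneOn (fun x => g x + w x) (Icc p q) := by
    refine monotoneOn_of_deriv_nonneg (convex_Icc p q) (hg.add hw) ?_ ?_ <;>
      rw [interior_Icc] <;> intro x hx
    · exact ((hdg x hx).add (hdw x hx)).differentiableAt.differentiableWithinAt
    · have hd : HasDerivAt (fun x => g x + w x) (g' x + w' x) x := (hdg x hx).add (hdw x hx)
      rw [hd.deriv]
      linarith [neg_abs_le (w' x), h x hx]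
  have hpm : p ∈ Icc p q := left_mem_Icc.2 hpq.le
  have hqm : q ∈ Icc p q := right_mem_Icc.2 hpq.le
  have a1 := m1 hpm hy hy.1
  have a2 := m1 hy hqm hy.2
  have a3 := m1 hpm hz hz.1
  have a4 := m1 hz hqm hz.2
  have b1 := m2 hpm hy hy.1
  have b2 := m2 hy hqm hy.2
  have b3 := m2 hpm hz hz.1
  have b4 := m2 hz hqm hz.2
  simp only at a1 a2 a3 a4 b1 b2 b3 b4
  rcases le_total y z with hyz | hyz
  · have c1 := m1 hy hz hyz
    have c2 := m2 hy hz hyz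
    simp only at c1 c2
    rw [abs_le]; constructor <;> linarith
  · have c1 := m1 hz hy hyz
    have c2 := m2 hz hy hyz
    simp only at c1 c2
    rw [abs_le]; constructor <;> linarith

theorem MeshCell.variation_le (hlam0 : 0 < lam) (hCu : 0 < Cu) (hη : 0 < η)
    (hC : MeshCell α η κ p q s0 s1) (hu : LayerFunction lam Cu η u u1 u2 u3)
    {y z : ℝ} (hy : y ∈ Icc p q) (hz : z ∈ Icc p q) :
    |u y - u z| ≤ Cu * (s1 + s1 ^ lam / lam) := by
  have hpm : p ∈ Icc p q := left_mem_Icc.2 hC.lt.le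
  have hqm : q ∈ Icc p q := right_mem_Icc.2 hC.lt.le
  have hh : q - p ≤ s1 := by linarith [hC.sub, hC.pos]
  have hrp : ∀ x ∈ Icc p q, (η + |x|) ^ lam ≤ s1 ^ lam := fun x hx =>
    Real.rpow_le_rpow (by positivity) (hC.upper x hx) hlam0.le
  have hrn : ∀ x : ℝ, 0 ≤ (η + |x|) ^ lam := fun x => Real.rpow_nonneg (by positivity) _
  rcases hC.side with h | h
  · have hpos : ∀ x ∈ Icc p q, |x| = x := fun x hx => abs_of_nonneg (h.trans hx.1)
    have hder : ∀ x ∈ Icc p q, HasDerivAt (fun x => Cu * (x + (η + x) ^ lam / lam))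
        (Cu * (1 + (η + x) ^ (lam - 1))) x := by
      intro x hx
      have hne : η + x ≠ 0 := by linarith [hx.1]
      have := (((hasDerivAt_id x).add
        ((((hasDerivAt_id x).const_add η).rpow_const (p := lam) (Or.inl hne)).div_const
          lam)).const_mul Cu)
      refine this.congr_deriv ?_
      simp only [id]
      field_simp
    have := abs_sub_le_of_dominated hC.lt (hu.cont.mono hC.subset)
      (fun x hx => (hder x hx).continuousAt.continuousWithinAt)
      (fun x hx => hu.deriv x (hC.subset' hx)) (fun x hx => hder x (Ioo_subset_Icc_self hx))
      (fun x hx => by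
        have h1 := hu.bound1 x (hC.subset (Ioo_subset_Icc_self hx))
        rwa [hpos x (Ioo_subset_Icc_self hx)] at h1) hy hz
    refine this.trans ?_
    have e1 := hrp q hqm
    have e2 := hrn p
    rw [hpos q hqm] at e1
    rw [hpos p hpm] at e2
    rw [← mul_sub]
    refine mul_le_mul_of_nonneg_left ?_ hCu.le
    have : (η + q) ^ lam / lam ≤ s1 ^ lam / lam := by gcongr
    have : 0 ≤ (η + p) ^ lam / lam := by positivity
    linarith
  · have hneg : ∀ x ∈ Icc p q, |x| = -x := fun x hx => abs_of_nonpos (hx.2.trans h)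
    have hder : ∀ x ∈ Icc p q, HasDerivAt (fun x => Cu * (x - (η + -x) ^ lam / lam))
        (Cu * (1 + (η + -x) ^ (lam - 1))) x := by
      intro x hx
      have hne : η + -x ≠ 0 := by linarith [hx.2]
      have := (((hasDerivAt_id x).sub
        ((((hasDerivAt_id x).neg.const_add η).rpow_const (p := lam) (Or.inl hne)).div_const
          lam)).const_mul Cu)
      refine this.congr_deriv ?_
      simp only [id, Pi.neg_apply]
      field_simp
      ring
    have := abs_sub_le_of_dominated hC.lt (hu.cont.mono hC.subset)
      (fun x hx => (hder x hx).continuousAt.continuousWithinAt)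
      (fun x hx => hu.deriv x (hC.subset' hx)) (fun x hx => hder x (Ioo_subset_Icc_self hx))
      (fun x hx => by
        have h1 := hu.bound1 x (hC.subset (Ioo_subset_Icc_self hx))
        rwa [hneg x (Ioo_subset_Icc_self hx)] at h1) hy hz
    refine this.trans ?_
    have e1 := hrp p hpm
    have e2 := hrn q
    rw [hneg p hpm] at e1
    rw [hneg q hqm] at e2
    rw [← mul_sub]
    refine mul_le_mul_of_nonneg_left ?_ hCu.le
    have : (η + -p) ^ lam / lam ≤ s1 ^ lam / lam := by gcongr
    have : 0 ≤ (η + -q) ^ lam / lam := by positivity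
    linarith

/-- Interpolation error on an irregular cell next to the origin. -/
theorem MeshCell.abs_error_le_of_irregular (hlam0 : 0 < lam) (hα0 : 0 < α) (hα : α ≤ 1 / 4)
    (hαl : α ≤ lam / 2) (hlam : lam < 2) (hCu : 0 < Cu) (hη : 0 < η)
    (hC : MeshCell α η κ p q s0 s1) (hirr : s0 ^ α ≤ κ)
    (hu : LayerFunction lam Cu η u u1 u2 u3) {k : ℝ}
    (hI : ∀ y ∈ Icc p q, uI y = uI p + k * (y - p)) (hIp : uI p = u p) (hIq : uI q = u q)
    {y : ℝ} (hy : y ∈ Icc p q) :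
    |uI y - u y| ≤ 16 * Cu * (1 + 1 / lam) * κ ^ 2 := by
  have hs1 : 0 < s1 := by linarith [hC.sub, hC.pos, hC.lt]
  have hh : 0 < q - p := sub_pos.2 hC.lt
  have h1 : s1 ^ α ≤ 2 * κ := by linarith [hC.rpow_sub]
  have h2 : (s1 ^ α) ^ 2 ≤ 4 * κ ^ 2 := by
    calc (s1 ^ α) ^ 2 ≤ (2 * κ) ^ 2 := by gcongr
      _ = _ := by ring
  have hsplit : ∀ b : ℝ, s1 ^ b = (s1 ^ α) ^ 2 * s1 ^ (b - 2 * α) := by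
    intro b
    rw [← Real.rpow_natCast, ← Real.rpow_mul hs1.le, ← Real.rpow_add hs1]
    push_cast; ring_nf
  have hpow : ∀ b : ℝ, 2 * α ≤ b → b ≤ 2 → s1 ^ b ≤ 16 * κ ^ 2 := by
    intro b hb hb2
    rw [hsplit]
    calc _ ≤ 4 * κ ^ 2 * 4 := by
          gcongr
          exact rpow_le_four hs1 hC.le_two (by linarith) (by linarith)
      _ = _ := by ring
  have e1 := hpow 1 (by linarith) (by norm_num)
  rw [Real.rpow_one] at e1
  have e2 := hpow lam (by linarith) hlam.le
  have hV : Cu * (s1 + s1 ^ lam / lam) ≤ 16 * Cu * (1 + 1 / lam) * κ ^ 2 := by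
    calc _ ≤ Cu * (16 * κ ^ 2 + 16 * κ ^ 2 / lam) := by gcongr
      _ = _ := by ring
  refine le_trans ?_ hV
  have hpm : p ∈ Icc p q := left_mem_Icc.2 hC.lt.le
  have hqm : q ∈ Icc p q := right_mem_Icc.2 hC.lt.le
  have v1 := hC.variation_le hlam0 hCu hη hu hpm hy
  have v2 := hC.variation_le hlam0 hCu hη hu hqm hy
  set V := Cu * (s1 + s1 ^ lam / lam)
  have hk : k * (q - p) = u q - u p := by
    have := hI q hqm
    rw [hIp, hIq] at this; linarith
  have hcomb : (q - p) * (uI y - u y) = (q - y) * (u p - u y) + (y - p) * (u q - u y) := by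
    rw [hI y hy, hIp]
    linear_combination (y - p) * hk
  have hfin : (q - p) * |uI y - u y| ≤ (q - p) * V := by
    rw [← abs_of_pos hh, ← abs_mul, abs_of_pos hh, hcomb]
    refine (abs_add_le _ _).trans ?_
    rw [abs_mul, abs_mul, abs_of_nonneg (sub_nonneg.2 hy.2), abs_of_nonneg (sub_nonneg.2 hy.1)]
    have := mul_le_mul_of_nonneg_left v1 (sub_nonneg.2 hy.2)
    have := mul_le_mul_of_nonneg_left v2 (sub_nonneg.2 hy.1)
    linarith
  exact le_of_mul_le_mul_left hfin hh

theorem MeshCell.abs_integral_le_of_irregular (hα0 : 0 < α) (hα : α ≤ 1 / 4)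
    (hαl : α ≤ lam / 2) (hlam : lam < 2) (hCu : 0 < Cu) (hη : 0 < η)
    (hC : MeshCell α η κ p q s0 s1) (hfirst : ∀ y ∈ Icc p q, |y| ≤ q - p)
    (ha : Convection L a a1) (hu : LayerFunction lam Cu η u u1 u2 u3) {E : ℝ}
    (hE : ∀ y ∈ Icc p q, |uI y - u y| ≤ E) :
    |∫ y in p..q, (a y * (uI y - u y) - meanDensity α η κ a u2 y)|
      ≤ L * (E + Cu * (κ / α) ^ 2) * (q - p) ^ 2 := by
  have hh : 0 < q - p := sub_pos.2 hC.lt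
  have hL := ha.nonneg
  have := intervalIntegral.norm_integral_le_of_norm_le_const (a := p) (b := q)
    (f := fun y => a y * (uI y - u y) - meanDensity α η κ a u2 y)
    (C := L * (q - p) * (E + Cu * (κ / α) ^ 2)) ?_
  · rw [abs_of_pos hh, Real.norm_eq_abs] at this
    exact this.trans_eq (by ring)
  · intro y hy
    rw [uIoc_of_le hC.lt.le] at hy
    have hy' := Ioc_subset_Icc_self hy
    have hs : 0 < η + |y| := by positivity
    have hw := weight_le hs ((hC.upper y hy').trans hC.le_two) hα0 hα hαl hlam
    have hA : |a y| ≤ L * (q - p) :=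
      (ha.abs_le (hC.subset hy')).trans (mul_le_mul_of_nonneg_left (hfirst y hy') hL)
    have hU2 := hu.bound2 y (hC.subset hy')
    have hp2 : 0 < (η + |y|) ^ (2 - 2 * α) := Real.rpow_pos_of_pos hs _
    have h1 : |a y * (uI y - u y)| ≤ L * (q - p) * E := by
      rw [abs_mul]
      exact mul_le_mul hA (hE y hy') (abs_nonneg _) (by positivity)
    have h2 : |meanDensity α η κ a u2 y| ≤ L * (q - p) * (Cu * (κ / α) ^ 2) := by
      rw [meanDensity, abs_mul, abs_mul, abs_mul, abs_of_pos hp2,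
        abs_of_nonneg (by positivity : 0 ≤ (κ / α) ^ 2 / 12)]
      calc _ ≤ (κ / α) ^ 2 / 12 * (L * (q - p) * (η + |y|) ^ (2 - 2 * α)
            * (Cu * (1 + (η + |y|) ^ (lam - 2)))) := by gcongr
        _ = (κ / α) ^ 2 / 12 * (L * (q - p)) * Cu
            * ((η + |y|) ^ (2 - 2 * α) * (1 + (η + |y|) ^ (lam - 2))) := by ring
        _ ≤ (κ / α) ^ 2 / 12 * (L * (q - p)) * Cu * 8 := by gcongr
        _ ≤ _ := by
          have : 0 ≤ (κ / α) ^ 2 * (L * (q - p)) * Cu := by positivity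
          linarith
    rw [Real.norm_eq_abs]
    refine (abs_sub _ _).trans ((add_le_add h1 h2).trans_eq (by ring))

end CellIntegral

/-! ### Liseikin's mesh -/

section Mesh

variable {α ε : ℝ} {N : ℕ}

theorem MeshCell.neg {η κ p q s0 s1 : ℝ} (h : MeshCell α η κ p q s0 s1) :
    MeshCell α η κ (-q) (-p) s0 s1 where
  lt := neg_lt_neg h.lt
  left := neg_le_neg h.right
  right := by linarith [h.left]
  pos := h.pos
  le_two := h.le_two
  sub := by linarith [h.sub]
  rpow_sub := h.rpow_sub
  lower y hy := by
    simpa using h.lower (-y) ⟨by linarith [hy.2], by linarith [hy.1]⟩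
  upper y hy := by
    simpa using h.upper (-y) ⟨by linarith [hy.2], by linarith [hy.1]⟩
  side := h.side.symm.imp neg_nonneg.2 neg_nonpos.2
  first := h.first.imp_right fun h y hy => by
    have := h (-y) ⟨by linarith [hy.2], by linarith [hy.1]⟩
    rw [abs_neg] at this
    linarith

/-- The increment of `(√ε + |x_i|) ^ α` from one mesh point to the next. -/
noncomputable def meshStep (α ε : ℝ) (N : ℕ) : ℝ :=
  ((1 + ε ^ ((1 : ℝ) / 2)) ^ α - ε ^ (α / 2)) / N

/-- The value of `√ε + |x|` at the mesh points `x = x_i` and `x = x_{-i}`. -/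
noncomputable def layerNode (α ε : ℝ) (N i : ℕ) : ℝ :=
  (ε ^ (α / 2) + i * meshStep α ε N) ^ (1 / α)

theorem rpow_half_mul (hε : 0 < ε) : ε ^ (α / 2) = (ε ^ ((1 : ℝ) / 2)) ^ α := by
  rw [← Real.rpow_mul hε.le]; ring_nf

theorem meshStep_pos (hα0 : 0 < α) (hε : 0 < ε) (hN : 1 ≤ N) : 0 < meshStep α ε N := by
  have : (0 : ℝ) < N := by exact_mod_cast hN
  refine div_pos (sub_pos.2 ?_) this
  rw [rpow_half_mul hε]
  exact Real.rpow_lt_rpow (by positivity) (by linarith) hα0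

theorem meshStep_le (hα : α ≤ 1) (hε : 0 < ε) (hε1 : ε ≤ 1) :
    meshStep α ε N ≤ 2 / N := by
  have hη : (0 : ℝ) < ε ^ ((1 : ℝ) / 2) := by positivity
  have hη1 : ε ^ ((1 : ℝ) / 2) ≤ 1 := Real.rpow_le_one hε.le hε1 (by norm_num)
  have h1 : (1 + ε ^ ((1 : ℝ) / 2)) ^ α ≤ 1 + ε ^ ((1 : ℝ) / 2) :=
    Real.rpow_le_self_of_one_le (by linarith) hα
  have h2 : (0 : ℝ) < ε ^ (α / 2) := by positivity
  unfold meshStep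
  gcongr
  linarith

theorem layerNode_rpow (hα0 : 0 < α) (hε : 0 < ε) (hN : 1 ≤ N) (i : ℕ) :
    layerNode α ε N i ^ α = ε ^ (α / 2) + i * meshStep α ε N := by
  have := meshStep_pos hα0 hε hN
  rw [layerNode, ← Real.rpow_mul (by positivity), one_div_mul_cancel hα0.ne', Real.rpow_one]

theorem layerNode_pos (hα0 : 0 < α) (hε : 0 < ε) (hN : 1 ≤ N) (i : ℕ) :
    0 < layerNode α ε N i := by
  have := meshStep_pos hα0 hε hN
  exact Real.rpow_pos_of_pos (by positivity) _

theorem layerNode_zero (hα0 : 0 < α) (hε : 0 < ε) : layerNode α ε N 0 = ε ^ ((1 : ℝ) / 2) := by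
  rw [layerNode, Nat.cast_zero, zero_mul, add_zero, ← Real.rpow_mul hε.le]
  congr 1
  field_simp

theorem layerNode_last (hα0 : 0 < α) (hε : 0 < ε) (hN : 1 ≤ N) :
    layerNode α ε N N = 1 + ε ^ ((1 : ℝ) / 2) := by
  have : (N : ℝ) ≠ 0 := by positivity
  have hη : (0 : ℝ) < ε ^ ((1 : ℝ) / 2) := by positivity
  rw [layerNode, meshStep, mul_div_cancel₀ _ this, add_sub_cancel, ← Real.rpow_mul (by positivity),
    mul_one_div_cancel hα0.ne', Real.rpow_one]

theorem layerNode_strictMono (hα0 : 0 < α) (hε : 0 < ε) (hN : 1 ≤ N) :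
    StrictMono (layerNode α ε N) := by
  have := meshStep_pos hα0 hε hN
  intro i j hij
  have : (i : ℝ) < j := by exact_mod_cast hij
  unfold layerNode
  gcongr

theorem liseikinX_natCast (i : ℕ) :
    liseikinX α ε N i = layerNode α ε N i - ε ^ ((1 : ℝ) / 2) := by
  rw [liseikinX, liseikinPhi, if_pos (by positivity), layerNode, meshStep]
  push_cast
  ring_nf

theorem liseikinX_neg (hα0 : 0 < α) (hε : 0 < ε) (hN : 1 ≤ N) (i : ℤ) :
    liseikinX α ε N (-i) = -liseikinX α ε N i := by
  have hN' : (0 : ℝ) < N := by exact_mod_cast hN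
  wlog hi : 0 < i generalizing i
  · rcases (not_lt.1 hi).lt_or_eq with h | rfl
    · have := this (-i) (by omega)
      rw [neg_neg] at this
      rw [this, neg_neg]
    · have := liseikinX_natCast (α := α) (ε := ε) (N := N) 0
      rw [layerNode_zero hα0 hε, sub_self, Nat.cast_zero] at this
      simp [this]
  have hi' : (0 : ℝ) < i := by exact_mod_cast hi
  have h1 : 0 < (i : ℝ) / N := by positivity
  rw [liseikinX, liseikinX, liseikinPhi, liseikinPhi, if_pos h1.le, if_neg]
  · push_cast
    ring_nf
  · push_cast
    rw [neg_div]
    linarith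

theorem meshCell_natCast (hα0 : 0 < α) (hε : 0 < ε) (hε1 : ε ≤ 1) (hN : 1 ≤ N) {i : ℕ}
    (hi : i < N) :
    MeshCell α (ε ^ ((1 : ℝ) / 2)) (meshStep α ε N) (liseikinX α ε N i)
      (liseikinX α ε N ((i + 1 : ℕ) : ℤ)) (layerNode α ε N i) (layerNode α ε N (i + 1)) := by
  have hη1 : ε ^ ((1 : ℝ) / 2) ≤ 1 := Real.rpow_le_one hε.le hε1 (by norm_num)
  have hm := layerNode_strictMono hα0 hε hN
  have h0 := hm.monotone (Nat.zero_le i)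
  have h1 := hm (Nat.lt_succ_self i)
  have h2 := hm.monotone (Nat.succ_le_of_lt hi)
  have hκ := meshStep_pos hα0 hε hN
  simp only [Nat.succ_eq_add_one] at h1 h2
  rw [layerNode_zero hα0 hε] at h0
  rw [layerNode_last hα0 hε hN] at h2
  rw [liseikinX_natCast, liseikinX_natCast]
  refine ⟨by linarith, by linarith, by linarith, layerNode_pos hα0 hε hN i, by linarith,
    by ring, ?_, ?_, ?_, Or.inl (by linarith), ?_⟩
  · rw [layerNode_rpow hα0 hε hN, layerNode_rpow hα0 hε hN]
    push_cast
    ring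
  · intro y hy
    linarith [hy.1, le_abs_self y]
  · intro y hy
    rw [abs_of_nonneg (by linarith [hy.1])]
    linarith [hy.2]
  · rcases Nat.eq_zero_or_pos i with rfl | hi0
    · right
      intro y hy
      rw [layerNode_zero hα0 hε] at hy ⊢
      rw [abs_of_nonneg (by linarith [hy.1])]
      linarith [hy.2]
    · left
      have : (1 : ℝ) ≤ i := by exact_mod_cast hi0
      have := mul_le_mul_of_nonneg_right this hκ.le
      have : (0 : ℝ) < ε ^ (α / 2) := by positivity
      rw [layerNode_rpow hα0 hε hN]
      linarith

/-- The points of Liseikin's mesh, numbered from `0` to `2 N`. -/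
noncomputable def meshNode (α ε : ℝ) (N j : ℕ) : ℝ :=
  liseikinX α ε N ((j : ℤ) - N)

theorem meshNode_last (hα0 : 0 < α) (hε : 0 < ε) (hN : 1 ≤ N) :
    meshNode α ε N (2 * N) = 1 := by
  rw [meshNode, show (((2 * N : ℕ) : ℤ) - N) = (N : ℕ) by push_cast; ring, liseikinX_natCast,
    layerNode_last hα0 hε hN]
  ring

theorem meshNode_zero (hα0 : 0 < α) (hε : 0 < ε) (hN : 1 ≤ N) : meshNode α ε N 0 = -1 := by
  rw [meshNode, Nat.cast_zero, zero_sub, liseikinX_neg hα0 hε hN, liseikinX_natCast,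
    layerNode_last hα0 hε hN]
  ring

theorem meshNode_middle (hα0 : 0 < α) (hε : 0 < ε) : meshNode α ε N N = 0 := by
  rw [meshNode, sub_self, ← Nat.cast_zero, liseikinX_natCast, layerNode_zero hα0 hε, sub_self]

theorem exists_meshCell (hα0 : 0 < α) (hε : 0 < ε) (hε1 : ε ≤ 1) (hN : 1 ≤ N) {j : ℕ}
    (hj : j < 2 * N) :
    ∃ s0 s1, MeshCell α (ε ^ ((1 : ℝ) / 2)) (meshStep α ε N) (meshNode α ε N j)
      (meshNode α ε N (j + 1)) s0 s1 := by
  unfold meshNode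
  rcases lt_or_ge j N with h | h
  · have := (meshCell_natCast hα0 hε hε1 hN (i := N - 1 - j) (by omega)).neg
    rw [← liseikinX_neg hα0 hε hN, ← liseikinX_neg hα0 hε hN] at this
    rw [show (j : ℤ) - N = -((N - 1 - j + 1 : ℕ) : ℤ) by omega,
      show ((j + 1 : ℕ) : ℤ) - N = -((N - 1 - j : ℕ) : ℤ) by omega]
    exact ⟨_, _, this⟩
  · have := meshCell_natCast hα0 hε hε1 hN (i := j - N) (by omega)
    rw [show (j : ℤ) - N = ((j - N : ℕ) : ℤ) by omega,
      show ((j + 1 : ℕ) : ℤ) - N = ((j - N + 1 : ℕ) : ℤ) by omega]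
    exact ⟨_, _, this⟩

theorem MemVN1.sub {x : ℤ → ℝ} {v w : ℝ → ℝ} (hv : MemVN1 x N v) (hw : MemVN1 x N w) :
    MemVN1 x N fun y => v y - w y := by
  refine ⟨hv.1.sub hw.1, by simp [hv.2.1, hw.2.1], by simp [hv.2.2.1, hw.2.2.1], ?_⟩
  intro i hi hi' y hy
  simp only
  rw [hv.2.2.2 i hi hi' y hy, hw.2.2.2 i hi hi' y hy]
  ring

theorem MemVN1.piecewiseAffine (hα0 : 0 < α) (hε : 0 < ε) (hN : 1 ≤ N) {v : ℝ → ℝ}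
    (hv : MemVN1 (liseikinX α ε N) N v) : PiecewiseAffine (meshNode α ε N) (2 * N) v := by
  refine ⟨?_, ?_, ?_, fun j hj => ?_⟩
  · rw [meshNode_zero hα0 hε hN, meshNode_last hα0 hε hN]; exact hv.1
  · rw [meshNode_zero hα0 hε hN]; exact hv.2.1
  · rw [meshNode_last hα0 hε hN]; exact hv.2.2.1
  · have h := hv.2.2.2 ((j : ℤ) - N + 1) (by omega) (by omega)
    rw [add_sub_cancel_right] at h
    refine ⟨_, fun y hy => h y ?_⟩
    convert hy using 2
    rw [meshNode]
    congr 1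
    push_cast
    ring

end Mesh

/-! ### The supercloseness bound -/

section Supercloseness

variable {α lam Cu L η κ ε : ℝ} {N : ℕ} {a a1 u u1 u2 u3 uI : ℝ → ℝ}

theorem exists_convection (ha : ContDiffOn ℝ 1 a (Icc (-1) 1)) (ha0 : a 0 = 0) :
    ∃ L, Convection L a (derivWithin a (Icc (-1) 1)) := by
  have hU : UniqueDiffOn ℝ (Icc (-1 : ℝ) 1) := uniqueDiffOn_Icc (by norm_num)
  have h1 := ha.continuousOn_derivWithin hU le_rfl
  obtain ⟨L, hL⟩ := isCompact_Icc.exists_bound_of_continuousOn h1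
  refine ⟨L, ha.continuousOn, h1, fun y hy => ?_, hL, ha0⟩
  exact ((ha.differentiableOn one_ne_zero y (Ioo_subset_Icc_self hy)).hasDerivWithinAt).hasDerivAt
    (Icc_mem_nhds hy.1 hy.2)

theorem hasDerivAt_iteratedDerivWithin {n m : ℕ} (hu : ContDiffOn ℝ n u (Icc (-1) 1)) (hm : m < n)
    {y : ℝ} (hy : y ∈ Ioo (-1 : ℝ) 1) :
    HasDerivAt (iteratedDerivWithin m u (Icc (-1) 1))
      (iteratedDerivWithin (m + 1) u (Icc (-1) 1) y) y := by
  have hU : UniqueDiffOn ℝ (Icc (-1 : ℝ) 1) := uniqueDiffOn_Icc (by norm_num)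
  rw [iteratedDerivWithin_succ]
  exact ((hu.differentiableOn_iteratedDerivWithin (by exact_mod_cast hm) hU y
    (Ioo_subset_Icc_self hy)).hasDerivWithinAt).hasDerivAt (Icc_mem_nhds hy.1 hy.2)

theorem layerFunction_of_contDiffOn (hu : ContDiffOn ℝ 3 u (Icc (-1) 1))
    (hb : ∀ i : ℕ, i ≤ 3 → ∀ y ∈ Icc (-1 : ℝ) 1,
      |iteratedDerivWithin i u (Icc (-1) 1) y| ≤ Cu * (1 + (η + |y|) ^ (lam - i))) :
    LayerFunction lam Cu η u (derivWithin u (Icc (-1) 1)) (iteratedDerivWithin 2 u (Icc (-1) 1))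
      (iteratedDerivWithin 3 u (Icc (-1) 1)) := by
  have hU : UniqueDiffOn ℝ (Icc (-1 : ℝ) 1) := uniqueDiffOn_Icc (by norm_num)
  have hu' : ContDiffOn ℝ ((3 : ℕ) : WithTop ℕ∞) u (Icc (-1) 1) := by exact_mod_cast hu
  have hc : ∀ m : ℕ, m ≤ 3 → ContinuousOn (iteratedDerivWithin m u (Icc (-1) 1)) (Icc (-1) 1) :=
    fun m hm => hu'.continuousOn_iteratedDerivWithin (by exact_mod_cast hm) hU
  rw [← iteratedDerivWithin_one]
  refine ⟨hu.continuousOn, hc 1 (by norm_num), hc 2 (by norm_num), hc 3 le_rfl, fun y hy => ?_,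
    fun y hy => hasDerivAt_iteratedDerivWithin hu' (by norm_num) hy,
    fun y hy => hasDerivAt_iteratedDerivWithin hu' (by norm_num) hy, ?_, ?_, ?_⟩
  · simpa using hasDerivAt_iteratedDerivWithin (m := 0) hu' (by norm_num) hy
  · exact_mod_cast hb 1 (by norm_num)
  · exact_mod_cast hb 2 (by norm_num)
  · exact_mod_cast hb 3 le_rfl

theorem piecewiseCont_meanDensityDeriv {t : ℕ → ℝ} {n : ℕ} (hη : 0 < η)
    (ht : ∀ j < n, ∃ s0 s1, MeshCell α η κ (t j) (t (j + 1)) s0 s1) (ha : Convection L a a1)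
    (hu : LayerFunction lam Cu η u u1 u2 u3) :
    PiecewiseCont t n (meanDensityDeriv α η κ a a1 u2 u3) := by
  intro j hj
  obtain ⟨s0, s1, hC⟩ := ht j hj
  obtain ⟨σ, hσ⟩ : ∃ σ : ℝ, ∀ y ∈ Ioo (t j) (t (j + 1)), (SignType.sign y : ℝ) = σ := by
    rcases hC.side with h | h
    · exact ⟨1, fun y hy => by rw [sign_pos (h.trans_lt hy.1)]; simp⟩
    · exact ⟨-1, fun y hy => by rw [sign_neg (hy.2.trans_le h)]; simp⟩
  refine ⟨fun y => (κ / α) ^ 2 / 12 *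
    ((a1 y * (η + |y|) ^ (2 - 2 * α)
      + a y * (σ * (2 - 2 * α) * (η + |y|) ^ (1 - 2 * α))) * u2 y
      + a y * (η + |y|) ^ (2 - 2 * α) * u3 y), ?_, fun y hy => ?_⟩
  · have h1 := (continuous_layer_rpow hη (1 - 2 * α)).continuousOn (s := Icc (-1 : ℝ) 1)
    have h2 := (continuous_layer_rpow hη (2 - 2 * α)).continuousOn (s := Icc (-1 : ℝ) 1)
    refine ContinuousOn.mono (continuousOn_const.mul ?_) hC.subset
    exact (((ha.cont1.mul h2).add (ha.cont.mul (continuousOn_const.mul h1))).mul hu.cont2).add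
      ((ha.cont.mul h2).mul hu.cont3)
  · rw [meanDensityDeriv, hσ y hy]

/-- The constant of the interpolation error bound on Liseikin's mesh. -/
noncomputable def interpConst (lam α Cu : ℝ) : ℝ :=
  8 * Cu * (2 ^ (1 / α)) ^ 2 / α ^ 2 + 16 * Cu * (1 + 1 / lam)

theorem div_sq_le_interpConst (hlam0 : 0 < lam) (hα0 : 0 < α) (hCu : 0 < Cu) :
    8 * Cu / α ^ 2 ≤ interpConst lam α Cu := by
  have hR : (1 : ℝ) ≤ 2 ^ (1 / α) := Real.one_le_rpow (by norm_num) (by positivity)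
  have hR2 : (1 : ℝ) ≤ (2 ^ (1 / α)) ^ 2 := one_le_pow₀ hR
  have h1 : 8 * Cu * 1 / α ^ 2 ≤ 8 * Cu * (2 ^ (1 / α)) ^ 2 / α ^ 2 := by gcongr
  have h2 : 0 < 16 * Cu * (1 + 1 / lam) := by positivity
  rw [mul_one] at h1
  exact h1.trans (le_add_of_nonneg_right h2.le)

theorem MeshCell.abs_error_le_interpConst {p q s0 s1 : ℝ} (hlam0 : 0 < lam) (hlam : lam < 2)
    (hα0 : 0 < α) (hα : α ≤ 1 / 4) (hαl : α ≤ lam / 2) (hCu : 0 < Cu) (hη : 0 < η)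
    (hC : MeshCell α η κ p q s0 s1) (hu : LayerFunction lam Cu η u u1 u2 u3) {k : ℝ}
    (hI : ∀ y ∈ Icc p q, uI y = uI p + k * (y - p)) (hIp : uI p = u p) (hIq : uI q = u q)
    {y : ℝ} (hy : y ∈ Icc p q) : |uI y - u y| ≤ interpConst lam α Cu * κ ^ 2 := by
  have e : interpConst lam α Cu * κ ^ 2 = 8 * Cu * (2 ^ (1 / α)) ^ 2 * (κ / α) ^ 2
      + 16 * Cu * (1 + 1 / lam) * κ ^ 2 := by rw [interpConst]; ring
  have h1 : 0 ≤ 8 * Cu * (2 ^ (1 / α)) ^ 2 * (κ / α) ^ 2 := by positivity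
  have h2 : 0 ≤ 16 * Cu * (1 + 1 / lam) * κ ^ 2 := by positivity
  rw [e]
  rcases le_total κ (s0 ^ α) with h | h
  · have := hC.abs_error_le hα0 hα hαl hlam hCu h hu hI hIp hIq hy
    linarith
  · have := hC.abs_error_le_of_irregular hlam0 hα0 hα hαl hlam hCu hη h hu hI hIp hIq hy
    linarith

theorem MeshCell.abs_integral_le {p q s0 s1 : ℝ} (hlam0 : 0 < lam) (hlam : lam < 2)
    (hα0 : 0 < α) (hα : α ≤ 1 / 4) (hαl : α ≤ lam / 2) (hCu : 0 < Cu) (hη : 0 < η) (hη1 : η ≤ 1)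
    (hC : MeshCell α η κ p q s0 s1) (ha : Convection L a a1)
    (hu : LayerFunction lam Cu η u u1 u2 u3) {k : ℝ}
    (hI : ∀ y ∈ Icc p q, uI y = uI p + k * (y - p)) (hIp : uI p = u p) (hIq : uI q = u q) :
    |∫ y in p..q, (a y * (uI y - u y) - meanDensity α η κ a u2 y)|
      ≤ 5 * L * 2 ^ (1 / α) * interpConst lam α Cu * κ ^ 2 * (q - p) ^ 2 := by
  have hL := ha.nonneg
  have hR : (1 : ℝ) ≤ 2 ^ (1 / α) := Real.one_le_rpow (by norm_num) (by positivity)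
  have hE := div_sq_le_interpConst hlam0 hα0 hCu
  have hE0 : 0 ≤ interpConst lam α Cu := le_trans (by positivity) hE
  by_cases hreg : κ ≤ s0 ^ α
  · refine (hC.abs_integral_le_of_regular hα0 hα hαl hlam hCu hη hη1 hreg ha hu hI hIp
      hIq).trans ?_
    have : 8 * Cu * (2 ^ (1 / α)) ^ 2 * (κ / α) ^ 2 ≤ interpConst lam α Cu * κ ^ 2 := by
      have : 0 ≤ 16 * Cu * (1 + 1 / lam) * κ ^ 2 := by positivity
      have e : interpConst lam α Cu * κ ^ 2 = 8 * Cu * (2 ^ (1 / α)) ^ 2 * (κ / α) ^ 2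
        + 16 * Cu * (1 + 1 / lam) * κ ^ 2 := by rw [interpConst]; ring
      linarith
    calc _ ≤ 5 * L * 2 ^ (1 / α) * (interpConst lam α Cu * κ ^ 2) * (q - p) ^ 2 := by gcongr
      _ = _ := by ring
  · refine (hC.abs_integral_le_of_irregular hα0 hα hαl hlam hCu hη (hC.first.resolve_left hreg)
      ha hu fun y hy =>
      hC.abs_error_le_interpConst hlam0 hlam hα0 hα hαl hCu hη hu hI hIp hIq hy).trans ?_
    have h1 : Cu * (κ / α) ^ 2 ≤ interpConst lam α Cu * κ ^ 2 := by
      have := mul_le_mul_of_nonneg_right hE (sq_nonneg κ)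
      have e : 8 * Cu / α ^ 2 * κ ^ 2 = 8 * (Cu * (κ / α) ^ 2) := by ring
      have : 0 ≤ Cu * (κ / α) ^ 2 := by positivity
      linarith
    have h2 : interpConst lam α Cu * κ ^ 2 ≤ 2 ^ (1 / α) * (interpConst lam α Cu * κ ^ 2) :=
      le_mul_of_one_le_left (by positivity) hR
    have h3 : 0 ≤ interpConst lam α Cu * κ ^ 2 := by positivity
    calc _ ≤ L * (5 * (2 ^ (1 / α) * (interpConst lam α Cu * κ ^ 2))) * (q - p) ^ 2 := by
          gcongr; linarith
      _ = _ := by ring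

theorem energyNorm_sub_le {γ D : ℝ} {c f uN : ℝ → ℝ} (hlam0 : 0 < lam) (hlam : lam < 2)
    (hα0 : 0 < α) (hα : α ≤ 1 / 4) (hαl : α ≤ lam / 2) (hCu : 0 < Cu) (hγ : 0 < γ)
    (hε : 0 < ε) (hε1 : ε ≤ 1) (hN : 1 ≤ N) (ha : Convection L a a1)
    (hc : ContinuousOn c (Icc (-1) 1)) (hf : ContinuousOn f (Icc (-1) 1))
    (hcoer : ∀ y ∈ Icc (-1 : ℝ) 1, γ ≤ c y - a1 y / 2)
    (hD : ∀ y ∈ Icc (-1 : ℝ) 1, |c y - a1 y| ≤ D)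
    (hu : LayerFunction lam Cu (ε ^ ((1 : ℝ) / 2)) u u1 u2 u3)
    (hode : ∀ y ∈ Ioo (-1 : ℝ) 1, -ε * u2 y + a y * u1 y + c y * u y = f y)
    (hI : MemVN1 (liseikinX α ε N) N uI)
    (hnode : ∀ i : ℤ, -(N : ℤ) ≤ i → i ≤ N → uI (liseikinX α ε N i) = u (liseikinX α ε N i))
    (hNm : MemVN1 (liseikinX α ε N) N uN)
    (hgal : ∀ v, MemVN1 (liseikinX α ε N) N v → Beps ε a c uN v = ∫ y in (-1 : ℝ)..1, f y * v y) :
    energyNorm ε (fun y => uI y - uN y)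
      ≤ 32 * ((5 * L * 2 ^ (1 / α) + D) * interpConst lam α Cu) * √((1 + 2 / γ) / γ)
        / (N : ℝ) ^ 2 := by
  have hη : (0 : ℝ) < ε ^ ((1 : ℝ) / 2) := by positivity
  have hη1 : ε ^ ((1 : ℝ) / 2) ≤ 1 := Real.rpow_le_one hε.le hε1 (by norm_num)
  have hcells : ∀ j < 2 * N, ∃ s0 s1, MeshCell α (ε ^ ((1 : ℝ) / 2)) (meshStep α ε N)
      (meshNode α ε N j) (meshNode α ε N (j + 1)) s0 s1 := fun j hj =>
    exists_meshCell hα0 hε hε1 hN hj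
  have hκ := meshStep_pos hα0 hε hN
  have hκ2 := meshStep_le (N := N) (by linarith : α ≤ 1) hε hε1
  have hPI := MemVN1.piecewiseAffine hα0 hε hN hI
  have hPN := MemVN1.piecewiseAffine hα0 hε hN hNm
  have ht0 := meshNode_zero (N := N) hα0 hε hN
  have htn := meshNode_last (N := N) hα0 hε hN
  have htm := meshNode_middle (N := N) hα0 hε
  have hnode' : ∀ j ≤ 2 * N, uI (meshNode α ε N j) = u (meshNode α ε N j) := fun j hj =>
    hnode _ (by omega) (by omega)
  set η := ε ^ ((1 : ℝ) / 2) with hηdef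
  set κ := meshStep α ε N with hκdef
  set t := meshNode α ε N with htdef
  set E := interpConst lam α Cu with hEdef
  set R : ℝ := 2 ^ (1 / α) with hRdef
  have hR : (1 : ℝ) ≤ R := Real.one_le_rpow (by norm_num) (by positivity)
  have hL := ha.nonneg
  have hD0 : 0 ≤ D := (abs_nonneg _).trans (hD 0 (by simp))
  have hE8 : 8 * Cu / α ^ 2 ≤ E := div_sq_le_interpConst hlam0 hα0 hCu
  have hE0 : 0 ≤ E := le_trans (by positivity) hE8
  have ht : ∀ j < 2 * N, t j < t (j + 1) := fun j hj => by
    obtain ⟨s0, s1, hC⟩ := hcells j hj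
    exact hC.lt
  have hcell : ∀ j < 2 * N, |∫ y in (t j)..(t (j + 1)),
      (a y * (uI y - u y) - meanDensity α η κ a u2 y)|
      ≤ 5 * L * R * E * κ ^ 2 * (t (j + 1) - t j) ^ 2 := fun j hj => by
    obtain ⟨s0, s1, hC⟩ := hcells j hj
    obtain ⟨k, hk⟩ := hPI.affine j hj
    exact hC.abs_integral_le hlam0 hlam hα0 hα hαl hCu hη hη1 ha hu hk (hnode' j hj.le)
      (hnode' (j + 1) hj)
  have herr : ∀ y ∈ Ioo (t 0) (t (2 * N)), |uI y - u y| ≤ E * κ ^ 2 := fun y hy => by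
    obtain ⟨j, hj, hyj⟩ := exists_cell t (2 * N) (Ioo_subset_Ico_self hy)
    obtain ⟨s0, s1, hC⟩ := hcells j hj
    obtain ⟨k, hk⟩ := hPI.affine j hj
    exact hC.abs_error_le_interpConst hlam0 hlam hα0 hα hαl hCu hη hu hk (hnode' j hj.le)
      (hnode' (j + 1) hj) (Ico_subset_Icc_self hyj)
  have hG1 : ∀ y ∈ Icc (-1 : ℝ) 1, |meanDensityDeriv α η κ a a1 u2 u3 y|
      ≤ 5 * L * R * E * κ ^ 2 := fun y hy => by
    refine (abs_meanDensityDeriv_le hα0 hα hαl hlam hCu hη hη1 ha hu hy).trans ?_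
    have h1 := mul_le_mul_of_nonneg_right hE8 (mul_nonneg hL (sq_nonneg κ))
    have h2 : L * E * κ ^ 2 ≤ R * (L * E * κ ^ 2) := le_mul_of_one_le_left (by positivity) hR
    have h3 : 0 ≤ L * E * κ ^ 2 := by positivity
    have e : 8 * Cu / α ^ 2 * (L * κ ^ 2) = 2 * (4 * L * Cu * (κ / α) ^ 2) := by ring
    linarith
  set M := (5 * L * R + D) * E * κ ^ 2 with hM
  have hM0 : 0 ≤ M := by positivity
  have hM1 : 5 * L * R * E * κ ^ 2 ≤ M := by
    have : 0 ≤ D * E * κ ^ 2 := by positivity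
    rw [hM]; linarith
  have hM2 : D * (E * κ ^ 2) ≤ M := by
    have : 0 ≤ 5 * L * R * E * κ ^ 2 := by positivity
    rw [hM]; linarith
  have hpc := piecewiseCont_meanDensityDeriv hη hcells ha hu
  have hgal' := hgal _ (MemVN1.sub hI hNm)
  rw [Beps] at hgal'
  have hen := energy_bound (n := 2 * N) ht (ε := ε) (γ := γ) (M := M) (a := a) (a1 := a1) (c := c)
    (f := f) (u := u) (u1 := u1) (u2 := u2) (uI := uI) (uN := uN)
    (G := meanDensity α η κ a u2) (G1 := meanDensityDeriv α η κ a a1 u2 u3) hM0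
  rw [ht0, htn] at hen herr
  specialize hen ha.cont ha.cont1 hc hf ha.deriv
    (fun y hy => hcoer y (Ioo_subset_Icc_self hy)) hu.cont hu.cont1 hu.cont2 hu.deriv hu.deriv1
    hode hPI hPN hnode' hgal' (continuousOn_meanDensity hη ha hu) hpc
    (fun y hy => hasDerivAt_meanDensity hη ha hu hy.1 fun h => hy.2 ⟨N, by rw [htm, h]⟩)
    (fun j hj => (hcell j hj).trans (mul_le_mul_of_nonneg_right hM1 (sq_nonneg _)))
    (fun y hy => (hG1 y (Ioo_subset_Icc_self hy.1)).trans hM1)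
    (fun y hy => by
      rw [abs_mul]
      exact (mul_le_mul (hD y (Ioo_subset_Icc_self hy)) (herr y hy) (abs_nonneg _) hD0).trans hM2)
  have hsq := sqrt_energy_le (t := t) (n := 2 * N) (γ := γ) (M := 8 * M)
    (A := ε * ∫ y in (-1 : ℝ)..1, deriv (fun y => uI y - uN y) y ^ 2)
    (v := fun y => uI y - uN y)
  rw [ht0, htn] at hsq
  specialize hsq (by norm_num) hγ (by positivity) (hI.1.sub hNm.1) (by norm_num)
    (mul_nonneg hε.le (intervalIntegral.integral_nonneg (by norm_num) fun y _ => sq_nonneg _)) hen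
  refine hsq.trans ?_
  have hN0 : (0 : ℝ) < N := by exact_mod_cast hN
  calc 8 * M * √((1 + 2 / γ) / γ)
      = 8 * ((5 * L * R + D) * E) * √((1 + 2 / γ) / γ) * κ ^ 2 := by rw [hM]; ring
    _ ≤ 8 * ((5 * L * R + D) * E) * √((1 + 2 / γ) / γ) * (2 / N) ^ 2 := by gcongr
    _ = _ := by ring

end Supercloseness

end Liseikin

theorem supercloseness_liseikin (lam α Cu γ : ℝ)
    (hlam0 : 0 < lam) (hlam1 : lam < 2) (hCu : 0 < Cu) (hγ : 0 < γ)
    (hα0 : 0 < α) (hα : α ≤ min (lam / 2) (1/4))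
    (a c f : ℝ → ℝ)
    (ha : ContDiffOn ℝ 1 a (Set.Icc (-1) 1)) (hc : ContDiffOn ℝ 1 c (Set.Icc (-1) 1))
    (hf : ContDiffOn ℝ 1 f (Set.Icc (-1) 1)) (ha0 : a 0 = 0)
    (hcoer : ∀ y ∈ Set.Icc (-1:ℝ) 1, γ ≤ c y - derivWithin a (Set.Icc (-1) 1) y / 2) :
    ∃ C : ℝ, 0 < C ∧
      ∀ ε : ℝ, 0 < ε → ε ≤ 1 → ∀ N : ℕ, 1 ≤ N →
      ∀ u uI uN : ℝ → ℝ,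
        ContDiffOn ℝ 3 u (Set.Icc (-1) 1) → u (-1) = 0 → u 1 = 0 →
        (∀ y ∈ Set.Ioo (-1:ℝ) 1,
          -ε * iteratedDerivWithin 2 u (Set.Icc (-1) 1) y
            + a y * derivWithin u (Set.Icc (-1) 1) y + c y * u y = f y) →
        (∀ i : ℕ, i ≤ 3 → ∀ y ∈ Set.Icc (-1:ℝ) 1,
          |iteratedDerivWithin i u (Set.Icc (-1) 1) y|
            ≤ Cu * (1 + (ε ^ ((1:ℝ)/2) + |y|) ^ (lam - i))) →
        MemVN1 (liseikinX α ε N) N uI →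
        (∀ i : ℤ, -(N:ℤ) ≤ i → i ≤ N → uI (liseikinX α ε N i) = u (liseikinX α ε N i)) →
        MemVN1 (liseikinX α ε N) N uN →
        (∀ v, MemVN1 (liseikinX α ε N) N v →
          Beps ε a c uN v = ∫ y in (-1:ℝ)..1, f y * v y) →
        energyNorm ε (fun y => uI y - uN y) ≤ C / (N:ℝ) ^ 2 := by
  obtain ⟨L, hL⟩ := Liseikin.exists_convection ha ha0
  obtain ⟨D, hD⟩ := isCompact_Icc.exists_bound_of_continuousOn (hc.continuousOn.sub hL.cont1)
  obtain ⟨hαl, hα4⟩ := le_min_iff.1 hα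
  have hL0 := hL.nonneg
  have hD0 : 0 ≤ D := (norm_nonneg _).trans (hD 0 (by simp))
  have hE0 : 0 ≤ Liseikin.interpConst lam α Cu :=
    le_trans (by positivity) (Liseikin.div_sq_le_interpConst hlam0 hα0 hCu)
  refine ⟨32 * ((5 * L * 2 ^ (1 / α) + D) * Liseikin.interpConst lam α Cu)
    * √((1 + 2 / γ) / γ) + 1, by positivity, ?_⟩
  intro ε hε hε1 N hN u uI uN hu _ _ hode hb hI hnode hNm hgal
  refine (Liseikin.energyNorm_sub_le hlam0 hlam1 hα0 hα4 hαl hCu hγ hε hε1 hN hL hc.continuousOn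
    hf.continuousOn hcoer hD (Liseikin.layerFunction_of_contDiffOn hu hb) hode hI hnode hNm
    hgal).trans ?_
  gcongr
  linarith
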